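/- arXiv:math/0502413 — 4 statements merged into one kernel-verified Lean document; each statement's English description precedes it below -/
import Mathlib

section
/- (Inequality (5): Nikulin's estimate for i = 1, k = 2.) Let n ≥ 3 and let P be an n-dimensional simple polytope in ℝⁿ. Then the average number of edges of a 2-face of P satisfies α₂^{(1)} < 4(n−1+ε)/(n−2+ε). -/
open scoped BigOperators

noncomputable section

/-- `E n` is Euclidean `n`-space. -/
abbrev E (n : ℕ) := EuclideanSpace ℝ (Fin n)

/-- A polytope is the convex hull of a nonempty finite set of points. -/
def IsPolytope {n : ℕ} (P : Set (E n)) : Prop :=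
  ∃ S : Finset (E n), S.Nonempty ∧ P = convexHull ℝ (S : Set (E n))

/-- A face of `P` is a nonempty proper exposed face of `P`. -/
def IsFace {n : ℕ} (P F : Set (E n)) : Prop :=
  F.Nonempty ∧ F ≠ P ∧ IsExposed ℝ P F

/-- The dimension of a face: the rank of the direction of its affine span. -/
def faceDim {n : ℕ} (F : Set (E n)) : ℕ :=
  Module.finrank ℝ (affineSpan ℝ F).direction

/-- An `i`-face of `P` is a face of dimension `i`. -/
def IsIFace {n : ℕ} (P F : Set (E n)) (i : ℕ) : Prop :=
  IsFace P F ∧ faceDim F = i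

/-- The set of `i`-faces of `P`. -/
def facesOf {n : ℕ} (P : Set (E n)) (i : ℕ) : Set (Set (E n)) :=
  {F | IsIFace P F i}

/-- `P` is an `n`-dimensional simple polytope: it is a polytope affinely spanning `ℝⁿ`
and every `k`-face (`0 ≤ k ≤ n-1`) is contained in exactly `n - k` facets. -/
def IsSimplePolytope (n : ℕ) (P : Set (E n)) : Prop :=
  IsPolytope P ∧ affineSpan ℝ P = ⊤ ∧
    ∀ k : ℕ, k ≤ n - 1 → ∀ F : Set (E n), IsIFace P F k →
      {G : Set (E n) | IsIFace P G (n - 1) ∧ G ⊇ F}.ncard = n - k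

/-- `α i`: the number of `i`-faces of `P`. -/
def nFaces {n : ℕ} (P : Set (E n)) (i : ℕ) : ℕ :=
  (facesOf P i).ncard

/-- `αᵢ^f`: the number of `i`-faces of `P` contained in the face `f`. -/
def nFacesIn {n : ℕ} (P f : Set (E n)) (i : ℕ) : ℕ :=
  {G : Set (E n) | IsIFace P G i ∧ G ⊆ f}.ncard

/-- `α_k^{(i)}`: the average number of `i`-faces of a `k`-face of `P`. -/
def avgFaces {n : ℕ} (P : Set (E n)) (k i : ℕ) : ℝ :=
  (1 / (nFaces P k : ℝ)) * ∑ᶠ f ∈ facesOf P k, (nFacesIn P f i : ℝ)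

/-- `m i`: the number of 2-faces of `P` containing exactly `i` vertices of `P`. -/
def m2Faces {n : ℕ} (P : Set (E n)) (i : ℕ) : ℕ :=
  {F : Set (E n) | IsIFace P F 2 ∧ nFacesIn P F 0 = i}.ncard

end


lemma aux_ext_strict {n : ℕ} {S : Finset (E n)} {x : E n}
    (hx : x ∈ Set.extremePoints ℝ (convexHull ℝ (S : Set (E n)))) :
    x ∈ S ∧ ∃ l : E n →L[ℝ] ℝ, ∀ s ∈ S, s ≠ x → l s < l x := by
  have hxS : x ∈ S := by exact_mod_cast extremePoints_convexHull_subset hx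
  refine ⟨hxS, ?_⟩
  have h1 := ((convex_convexHull ℝ (S : Set (E n))).mem_extremePoints_iff_mem_sdiff_convexHull_sdiff).1 hx
  have h2 : x ∉ convexHull ℝ ((S : Set (E n)) \ {x}) := fun h =>
    h1.2 (convexHull_mono (Set.sdiff_subset_sdiff_left (subset_convexHull ℝ _)) h)
  have hf : ((S : Set (E n)) \ {x}).Finite := S.finite_toSet.sdiff
  obtain ⟨f, u, hu, hx'⟩ := geometric_hahn_banach_closed_point (convex_convexHull ℝ _)
    (hf.isClosed_convexHull (𝕜 := ℝ)) h2
  exact ⟨f, fun s hs hne => (hu s (subset_convexHull ℝ _ ⟨hs, hne⟩)).trans hx'⟩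

lemma aux_hull_ext {n : ℕ} (S : Finset (E n)) :
    convexHull ℝ (Set.extremePoints ℝ (convexHull ℝ (S : Set (E n)))) =
      convexHull ℝ (S : Set (E n)) := by
  have hfin : (Set.extremePoints ℝ (convexHull ℝ (S : Set (E n)))).Finite :=
    S.finite_toSet.subset extremePoints_convexHull_subset
  have := closure_convexHull_extremePoints (S.finite_toSet.isCompact_convexHull (𝕜 := ℝ))
    (convex_convexHull ℝ (S : Set (E n)))
  rwa [(hfin.isClosed_convexHull (𝕜 := ℝ)).closure_eq] at this

lemma aux_exposed {n : ℕ} {P : Set (E n)} {v : E n} (hv : v ∈ P) (φ : E n →L[ℝ] ℝ)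
    (h : ∀ x ∈ P, φ (x - v) ≤ 0) : IsExposed ℝ P {x | x ∈ P ∧ φ (x - v) = 0} := by
  intro _
  refine ⟨φ, ?_⟩
  ext x
  simp only [Set.mem_ofPred_eq, map_sub] at *
  constructor
  · rintro ⟨hx, h0⟩
    exact ⟨hx, fun y hy => by have := h y hy; linarith⟩
  · rintro ⟨hx, h0⟩
    exact ⟨hx, by have := h x hx; have := h0 v hv; linarith⟩

lemma aux_local {n : ℕ} {S : Finset (E n)} {v : E n}
    (hv : v ∈ Set.extremePoints ℝ (convexHull ℝ (S : Set (E n)))) :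
    ∃ (T : Finset (E n)) (m : E n →L[ℝ] ℝ),
      (∀ t ∈ T, m t = 1 ∧ (∃ c : ℝ, 0 < c ∧ v + c • t ∈ convexHull ℝ (S : Set (E n))) ∧
        ∃ φ : E n →L[ℝ] ℝ, φ t = 0 ∧ ∀ x ∈ convexHull ℝ (S : Set (E n)),
          φ (x - v) ≤ 0 ∧ (φ (x - v) = 0 → ∃ c : ℝ, 0 ≤ c ∧ x - v = c • t)) ∧
      ∀ x ∈ convexHull ℝ (S : Set (E n)), ∃ c : E n → ℝ, (∀ t, 0 ≤ c t) ∧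
        x - v = ∑ t ∈ T, c t • t := by
  classical
  obtain ⟨hvS, l, hl⟩ := aux_ext_strict hv
  set P := convexHull ℝ (S : Set (E n)) with hP
  let f : E n → E n := fun s => (l v - l s)⁻¹ • (s - v)
  let T0 : Finset (E n) := (S.erase v).image f
  have hfin : (Set.extremePoints ℝ (convexHull ℝ (T0 : Set (E n)))).Finite :=
    T0.finite_toSet.subset extremePoints_convexHull_subset
  let T := hfin.toFinset
  have hT : (T : Set (E n)) = Set.extremePoints ℝ (convexHull ℝ (T0 : Set (E n))) := by
    simp [T]
  have hfs : ∀ s ∈ S, s ≠ v → s - v = (l v - l s) • f s := by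
    intro s hs hne
    have : l v - l s ≠ 0 := by have := hl s hs hne; linarith
    simp only [f]
    rw [smul_smul, mul_inv_cancel₀ this, one_smul]
  refine ⟨T, -l, ?_, ?_⟩
  · intro t ht
    have ht' : t ∈ Set.extremePoints ℝ (convexHull ℝ (T0 : Set (E n))) := by
      rw [← hT]; exact ht
    obtain ⟨htT0, g, hg⟩ := aux_ext_strict ht'
    obtain ⟨s, hs, rfl⟩ := Finset.mem_image.1 htT0
    obtain ⟨hsv, hsS⟩ := Finset.mem_erase.1 hs
    have hpos : 0 < l v - l s := by have := hl s hsS hsv; linarith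
    have hls : ∀ s ∈ S, s ≠ v → l (f s) = -1 := by
      intro s hs hne
      have : l v - l s ≠ 0 := by have := hl s hs hne; linarith
      simp only [f, map_smul, map_sub, smul_eq_mul]
      field_simp
      ring
    refine ⟨by simp [hls s hsS hsv], ⟨l v - l s, hpos, ?_⟩, g + g (f s) • l, ?_, ?_⟩
    · rw [← hfs s hsS hsv, add_sub_cancel]
      exact subset_convexHull ℝ _ hsS
    · simp [hls s hsS hsv]
    · set φ : E n →L[ℝ] ℝ := g + g (f s) • l with hφ
      have hconv : Convex ℝ {x : E n | φ (x - v) ≤ 0 ∧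
          (φ (x - v) = 0 → ∃ c : ℝ, 0 ≤ c ∧ x - v = c • f s)} := by
        intro x hx y hy a b ha hb hab
        have e : a • x + b • y - v = a • (x - v) + b • (y - v) := by
          have : v = a • v + b • v := by rw [← add_smul, hab, one_smul]
          nth_rewrite 1 [this]
          module
        simp only [Set.mem_ofPred_eq] at hx hy ⊢
        rw [e]
        simp only [map_add, map_smul, smul_eq_mul]
        have h1 : a * φ (x - v) ≤ 0 := mul_nonpos_of_nonneg_of_nonpos ha hx.1
        have h2 : b * φ (y - v) ≤ 0 := mul_nonpos_of_nonneg_of_nonpos hb hy.1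
        refine ⟨by linarith, fun h0 => ?_⟩
        have h3 : a * φ (x - v) = 0 := by linarith
        have h4 : b * φ (y - v) = 0 := by linarith
        have k1 : ∃ c : ℝ, 0 ≤ c ∧ a • (x - v) = c • f s := by
          rcases mul_eq_zero.1 h3 with h | h
          · exact ⟨0, le_rfl, by simp [h]⟩
          · obtain ⟨c, hc, h⟩ := hx.2 h
            exact ⟨a * c, by positivity, by rw [h, smul_smul]⟩
        have k2 : ∃ c : ℝ, 0 ≤ c ∧ b • (y - v) = c • f s := by
          rcases mul_eq_zero.1 h4 with h | h
          · exact ⟨0, le_rfl, by simp [h]⟩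
          · obtain ⟨c, hc, h⟩ := hy.2 h
            exact ⟨b * c, by positivity, by rw [h, smul_smul]⟩
        obtain ⟨c, hc, h⟩ := k1
        obtain ⟨d, hd, h'⟩ := k2
        exact ⟨c + d, by positivity, by rw [h, h', add_smul]⟩
      intro x hx
      refine convexHull_min ?_ hconv hx
      intro s' hs'
      simp only [Set.mem_ofPred_eq]
      by_cases hne : s' = v
      · subst hne
        exact ⟨by simp, fun _ => ⟨0, le_rfl, by simp⟩⟩
      · have hs'S : s' ∈ S := hs'
        rw [hfs s' hs'S hne]
        have hp : 0 < l v - l s' := by have := hl s' hs'S hne; linarith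
        have hval : φ (f s') = g (f s') - g (f s) := by
          simp [hφ, hls s' hs'S hne, sub_eq_add_neg]
        by_cases heq : f s' = f s
        · refine ⟨by rw [map_smul, hval, heq]; simp, fun _ => ⟨_, hp.le, by rw [heq]⟩⟩
        · have := hg (f s') (Finset.mem_image_of_mem _ (Finset.mem_erase.2 ⟨hne, hs'S⟩)) heq
          have : (l v - l s') * φ (f s') < 0 := mul_neg_of_pos_of_neg hp (by rw [hval]; linarith)
          simp only [map_smul, smul_eq_mul]
          exact ⟨this.le, fun h => absurd h this.ne⟩
  · have hconv : Convex ℝ {x : E n | ∃ c : E n → ℝ, (∀ t, 0 ≤ c t) ∧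
        x - v = ∑ t ∈ T, c t • t} := by
      rintro x ⟨c, hc, hx⟩ y ⟨d, hd, hy⟩ a b ha hb hab
      refine ⟨fun t => a * c t + b * d t, fun t => by have := hc t; have := hd t; positivity, ?_⟩
      have e : a • x + b • y - v = a • (x - v) + b • (y - v) := by
        have : v = a • v + b • v := by rw [← add_smul, hab, one_smul]
        nth_rewrite 1 [this]
        module
      rw [e, hx, hy, Finset.smul_sum, Finset.smul_sum, ← Finset.sum_add_distrib]
      exact Finset.sum_congr rfl fun t _ => by module
    intro x hx
    refine convexHull_min ?_ hconv hx
    intro s hs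
    have hsS : s ∈ S := hs
    by_cases hne : s = v
    · exact ⟨0, fun _ => le_rfl, by simp [hne]⟩
    · have hp : 0 < l v - l s := by have := hl s hsS hne; linarith
      have hmem : f s ∈ convexHull ℝ (T : Set (E n)) := by
        rw [hT, aux_hull_ext]
        exact subset_convexHull ℝ _
          (Finset.mem_image_of_mem _ (Finset.mem_erase.2 ⟨hne, hsS⟩))
      rw [Finset.convexHull_eq] at hmem
      obtain ⟨w, hw, hw1, hw2⟩ := hmem
      refine ⟨fun t => if t ∈ T then (l v - l s) * w t else 0, ?_, ?_⟩
      · intro t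
        dsimp only
        split_ifs with h
        · exact mul_nonneg hp.le (hw t h)
        · exact le_rfl
      · rw [hfs s hsS hne, ← hw2, Finset.centerMass_eq_of_sum_1 _ _ hw1, Finset.smul_sum]
        refine Finset.sum_congr rfl fun t ht => ?_
        simp [ht, smul_smul]

lemma aux_dim {n : ℕ} {F : Set (E n)} {v : E n} (hv : v ∈ F) (A : Set (E n))
    (h1 : ∀ x ∈ F, x - v ∈ Submodule.span ℝ A) (h2 : ∀ a ∈ A, ∃ c : ℝ, 0 < c ∧ v + c • a ∈ F) :
    faceDim F = Module.finrank ℝ (Submodule.span ℝ A) := by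
  have : (affineSpan ℝ F).direction = Submodule.span ℝ A := by
    rw [direction_affineSpan, vectorSpan_eq_span_vsub_set_right ℝ hv]
    apply le_antisymm
    · rw [Submodule.span_le]
      rintro _ ⟨x, hx, rfl⟩
      exact h1 x hx
    · rw [Submodule.span_le]
      intro a ha
      obtain ⟨c, hc, h⟩ := h2 a ha
      have : c • a ∈ Submodule.span ℝ ((fun x => x -ᵥ v) '' F) :=
        Submodule.subset_span ⟨_, h, by simp⟩
      have := Submodule.smul_mem _ c⁻¹ this
      rwa [smul_smul, inv_mul_cancel₀ hc.ne', one_smul] at this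
  unfold faceDim
  rw [this]

lemma aux_dimP {n : ℕ} {P : Set (E n)} (h : affineSpan ℝ P = ⊤) : faceDim P = n := by
  unfold faceDim
  rw [h, AffineSubspace.direction_top, finrank_top, finrank_euclideanSpace_fin]

lemma aux_dim_mono {n : ℕ} {F G : Set (E n)} (h : F ⊆ G) : faceDim F ≤ faceDim G :=
  Submodule.finrank_mono (AffineSubspace.direction_le (affineSpan_mono ℝ h))

lemma aux_basis {n : ℕ} (hn : 3 ≤ n) {P : Set (E n)} (hP : IsSimplePolytope n P) {v : E n}
    (hv : v ∈ Set.extremePoints ℝ P) :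
    ∃ b : Module.Basis (Fin n) ℝ (E n), (∀ i, ∃ c : ℝ, 0 < c ∧ v + c • b i ∈ P) ∧
      ∀ x ∈ P, ∀ i, 0 ≤ b.repr (x - v) i := by
  classical
  obtain ⟨⟨S, hS, rfl⟩, haff, hsimp⟩ := hP
  obtain ⟨T, m, hT, hcone⟩ := aux_local hv
  set P := convexHull ℝ (S : Set (E n)) with hPdef
  have hvP : v ∈ P := hv.1
  have hdimP := aux_dimP haff
  -- `{v}` is a face
  have hvface : IsIFace P {v} 0 := by
    have hdim0 : faceDim ({v} : Set (E n)) = 0 := by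
      unfold faceDim
      rw [direction_affineSpan, vectorSpan_singleton, finrank_bot]
    refine ⟨⟨Set.singleton_nonempty v, ?_, ?_⟩, hdim0⟩
    · intro h
      rw [h] at hdim0
      omega
    · have key : ∀ x ∈ P, (-m) (x - v) ≤ 0 ∧ ((-m) (x - v) = 0 → x = v) := by
        intro x hx
        obtain ⟨c, hc, h⟩ := hcone x hx
        have hm : m (x - v) = ∑ t ∈ T, c t := by
          rw [h, map_sum]
          exact Finset.sum_congr rfl fun t ht => by simp [(hT t ht).1]
        have hnn : 0 ≤ ∑ t ∈ T, c t := Finset.sum_nonneg fun t _ => hc t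
        rw [neg_apply, hm]
        refine ⟨by linarith, fun h0 => ?_⟩
        have h0' : ∑ t ∈ T, c t = 0 := by linarith
        rw [Finset.sum_eq_zero_iff_of_nonneg fun t _ => hc t] at h0'
        rw [← sub_eq_zero, h]
        exact Finset.sum_eq_zero fun t ht => by simp [h0' t ht]
      have := aux_exposed hvP (-m) fun x hx => (key x hx).1
      convert this using 1
      ext x
      constructor
      · rintro rfl
        exact ⟨hvP, by simp⟩
      · rintro ⟨hx, h0⟩
        exact (key x hx).2 h0
  have hB := hsimp 0 (by omega) {v} hvface
  have hBfin : {G : Set (E n) | IsIFace P G (n - 1) ∧ G ⊇ {v}}.Finite :=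
    Set.finite_of_ncard_ne_zero (by omega)
  choose! hm hc φ hφt hφ using hT
  let Fa : E n → Set (E n) := fun t => {x | x ∈ P ∧ φ t (x - v) = 0}
  have hvFa : ∀ t, v ∈ Fa t := fun t => ⟨hvP, by simp⟩
  have hcFa : ∀ t ∈ T, ∃ c : ℝ, 0 < c ∧ v + c • t ∈ Fa t := by
    intro t ht
    obtain ⟨c, h1, h2⟩ := hc t ht
    exact ⟨c, h1, h2, by simp [hφt t ht]⟩
  have hFa : ∀ t ∈ T, IsIFace P (Fa t) 1 := by
    intro t ht
    have hd : faceDim (Fa t) = 1 := by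
      rw [aux_dim (hvFa t) {t}]
      · apply finrank_span_singleton
        rintro rfl
        have := hm 0 ht
        simp at this
      · rintro x ⟨hx, h0⟩
        obtain ⟨c, _, h⟩ := (hφ t ht x hx).2 h0
        exact Submodule.mem_span_singleton.2 ⟨c, h.symm⟩
      · rintro a rfl
        exact hcFa a ht
    refine ⟨⟨⟨v, hvFa t⟩, ?_, aux_exposed hvP _ fun x hx => (hφ t ht x hx).1⟩, hd⟩
    intro h
    rw [h] at hd
    omega
  have hcard : T.card ≤ n := by
    let f : E n → Finset (Set (E n)) := fun t => hBfin.toFinset.filter (fun G => Fa t ⊆ G)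
    have hfc : ∀ t, (f t : Set (Set (E n))) = {G | IsIFace P G (n - 1) ∧ G ⊇ Fa t} := by
      intro t
      ext G
      simp only [f, Finset.coe_filter, Set.Finite.mem_toFinset, Set.mem_ofPred_eq]
      constructor
      · rintro ⟨⟨h1, h2⟩, h3⟩
        exact ⟨h1, h3⟩
      · rintro ⟨h1, h3⟩
        exact ⟨⟨h1, fun x hx => by rw [hx]; exact h3 (hvFa t)⟩, h3⟩
    have hfcard : ∀ t ∈ T, (f t).card = n - 1 := by
      intro t ht
      rw [← Set.ncard_coe_finset, hfc]
      exact hsimp 1 (by omega) _ (hFa t ht)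
    have hle : T.card ≤ (hBfin.toFinset.powersetCard (n - 1)).card := by
      apply Finset.card_le_card_of_injOn f
      · intro t ht
        rw [Finset.mem_coe, Finset.mem_powersetCard]
        exact ⟨Finset.filter_subset _ _, hfcard t ht⟩
      · intro t ht t' ht' heq
        have hne : (f t).Nonempty := by
          rw [← Finset.card_pos, hfcard t ht]; omega
        have hmem : ∀ G, G ∈ f t ↔ (IsIFace P G (n - 1) ∧ G ⊇ Fa t) := fun G => by
          rw [← Finset.mem_coe, hfc]; rfl
        have hmem' : ∀ G, G ∈ f t' ↔ (IsIFace P G (n - 1) ∧ G ⊇ Fa t') := fun G => by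
          rw [← Finset.mem_coe, hfc]; rfl
        let F : Set (E n) := ⋂₀ (f t : Set (Set (E n)))
        have hFexp : IsExposed ℝ P F := IsExposed.sInter hne fun G hG => ((hmem G).1 hG).1.1.2.2
        have htF : Fa t ⊆ F := fun x hx G hG => ((hmem G).1 hG).2 hx
        have htF' : Fa t' ⊆ F := fun x hx G hG => by
          have hG' : G ∈ f t' := heq ▸ hG
          exact ((hmem' G).1 hG').2 hx
        obtain ⟨G0, hG0⟩ := hne
        have hG0' := (hmem G0).1 hG0
        have hFG : F ⊆ G0 := Set.sInter_subset_of_mem hG0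
        have hdF : faceDim F ≤ n - 1 := (aux_dim_mono hFG).trans hG0'.1.2.le
        have hFface : IsIFace P F (faceDim F) := by
          refine ⟨⟨⟨v, htF (hvFa t)⟩, ?_, hFexp⟩, rfl⟩
          intro h
          rw [h] at hdF
          omega
        have hcF := hsimp _ hdF F hFface
        have hge : n - 1 ≤ {G : Set (E n) | IsIFace P G (n - 1) ∧ G ⊇ F}.ncard := by
          have e0 := hfcard t ht
          rw [← Set.ncard_coe_finset] at e0
          refine e0.ge.trans (Set.ncard_le_ncard ?_ ?_)
          · intro G hG
            exact ⟨((hmem G).1 hG).1, Set.sInter_subset_of_mem hG⟩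
          · exact hBfin.subset fun G hG => ⟨hG.1, fun x hx => by
              rw [hx]; exact hG.2 (htF (hvFa t))⟩
        have hd1 : faceDim F ≤ 1 := by omega
        unfold faceDim at hd1
        obtain ⟨w, hw⟩ := finrank_le_one_iff.1 hd1
        have hdir : ∀ s ∈ T, Fa s ⊆ F → ∃ a : ℝ, a • (w : E n) = s := by
          intro s hs hsF
          obtain ⟨c, hc, h⟩ := hcFa s hs
          have h1 : (v + c • s) -ᵥ v ∈ (affineSpan ℝ F).direction :=
            AffineSubspace.vsub_mem_direction (subset_affineSpan ℝ _ (hsF h))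
              (subset_affineSpan ℝ _ (hsF (hvFa s)))
          rw [vsub_eq_sub, add_sub_cancel_left] at h1
          obtain ⟨a, ha⟩ := hw ⟨_, h1⟩
          have ha' : a • (w : E n) = c • s := congrArg Subtype.val ha
          exact ⟨c⁻¹ * a, by rw [mul_smul, ha', smul_smul, inv_mul_cancel₀ hc.ne', one_smul]⟩
        obtain ⟨a, ha⟩ := hdir t ht htF
        obtain ⟨a', ha'⟩ := hdir t' ht' htF'
        have e1 : a * m w = 1 := by rw [← hm t ht, ← ha]; simp
        have e2 : a' * m w = 1 := by rw [← hm t' ht', ← ha']; simp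
        have hw0 : m w ≠ 0 := by
          intro h; rw [h] at e1; simp at e1
        rw [← ha, ← ha', mul_right_cancel₀ hw0 (e1.trans e2.symm)]
    rw [Finset.card_powersetCard, ← Set.ncard_eq_toFinset_card _ hBfin, hB] at hle
    have : (n - 0).choose (n - 1) = n := by
      rw [Nat.sub_zero, Nat.choose_symm (by omega : 1 ≤ n), Nat.choose_one_right]
    omega
  have hspan : ⊤ ≤ Submodule.span ℝ (Set.range (Subtype.val : T → E n)) := by
    have h1 : (affineSpan ℝ P).direction = ⊤ := by rw [haff, AffineSubspace.direction_top]
    rw [← h1, direction_affineSpan, vectorSpan_eq_span_vsub_set_right ℝ hvP, Submodule.span_le]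
    rintro _ ⟨x, hx, rfl⟩
    obtain ⟨c, _, h⟩ := hcone x hx
    change x - v ∈ _
    rw [h]
    exact Submodule.sum_mem _ fun t ht => Submodule.smul_mem _ _
      (Submodule.subset_span ⟨⟨t, ht⟩, rfl⟩)
  have hcard2 : T.card = n := by
    apply le_antisymm hcard
    have := finrank_range_le_card (R := ℝ) (Subtype.val : T → E n)
    have h2 : Set.finrank ℝ (Set.range (Subtype.val : T → E n)) = n := by
      unfold Set.finrank
      rw [top_le_iff.1 hspan, finrank_top, finrank_euclideanSpace_fin]
    rw [h2] at this
    simpa using this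
  let b0 := basisOfTopLeSpanOfCardEqFinrank (Subtype.val : T → E n) hspan
    (by rw [finrank_euclideanSpace_fin, Fintype.card_coe, hcard2])
  have hb0 : ∀ t, b0 t = (t : E n) := fun t => by simp [b0]
  let e : T ≃ Fin n := T.equivFinOfCardEq hcard2
  refine ⟨b0.reindex e, ?_, ?_⟩
  · intro i
    obtain ⟨c, h1, h2⟩ := hc (e.symm i) (e.symm i).2
    exact ⟨c, h1, by rw [Module.Basis.reindex_apply, hb0]; exact h2⟩
  · intro x hx i
    obtain ⟨c, hc0, h⟩ := hcone x hx
    have h2 : x - v = ∑ t : T, c t • b0 t := by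
      rw [h, ← Finset.sum_coe_sort T]
      exact Finset.sum_congr rfl fun t _ => by rw [hb0]
    rw [Module.Basis.repr_reindex_apply, h2, Module.Basis.repr_sum_self]
    exact hc0 _

/-- `b` is a basis of edge directions of `P` at the vertex `v`, whose cone contains `P`. -/
def AuxGood {n : ℕ} (P : Set (E n)) (v : E n) (b : Module.Basis (Fin n) ℝ (E n)) : Prop :=
  v ∈ P ∧ (∀ i, ∃ c : ℝ, 0 < c ∧ v + c • b i ∈ P) ∧ ∀ x ∈ P, ∀ i, 0 ≤ b.repr (x - v) i

/-- The face at `v` spanned by the edge directions in `I`. -/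
def auxFc {n : ℕ} (P : Set (E n)) (v : E n) (b : Module.Basis (Fin n) ℝ (E n))
    (I : Finset (Fin n)) : Set (E n) :=
  {x | x ∈ P ∧ ∀ i, i ∉ I → b.repr (x - v) i = 0}

lemma aux_mem_self {n : ℕ} {P : Set (E n)} {v : E n} {b : Module.Basis (Fin n) ℝ (E n)}
    (hb : AuxGood P v b) (I : Finset (Fin n)) : v ∈ auxFc P v b I :=
  ⟨hb.1, fun i _ => by simp⟩

lemma aux_mem_edge {n : ℕ} {P : Set (E n)} {v : E n} {b : Module.Basis (Fin n) ℝ (E n)}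
    (hb : AuxGood P v b) (I : Finset (Fin n)) {i : Fin n} (hi : i ∈ I) :
    ∃ c : ℝ, 0 < c ∧ v + c • b i ∈ auxFc P v b I := by
  classical
  obtain ⟨c, hc, h⟩ := hb.2.1 i
  refine ⟨c, hc, h, fun j hj => ?_⟩
  have : i ≠ j := fun h => hj (h ▸ hi)
  simp [this]

lemma aux_fc_exposed {n : ℕ} {P : Set (E n)} {v : E n} {b : Module.Basis (Fin n) ℝ (E n)}
    (hb : AuxGood P v b) (I : Finset (Fin n)) : IsExposed ℝ P (auxFc P v b I) := by
  classical
  let φ : E n →L[ℝ] ℝ := LinearMap.toContinuousLinearMap (-∑ i ∈ Iᶜ, b.coord i)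
  have hφ : ∀ x, φ x = -∑ i ∈ Iᶜ, b.repr x i := by
    intro x; simp [φ]
  have hnn : ∀ x ∈ P, 0 ≤ ∑ i ∈ Iᶜ, b.repr (x - v) i := fun x hx =>
    Finset.sum_nonneg fun i _ => hb.2.2 x hx i
  have := aux_exposed hb.1 φ fun x hx => by rw [hφ]; have := hnn x hx; linarith
  convert this using 1
  ext x
  refine and_congr_right fun hx => ?_
  rw [hφ, neg_eq_zero, Finset.sum_eq_zero_iff_of_nonneg fun i _ => hb.2.2 x hx i]
  simp

lemma aux_fc_dim {n : ℕ} {P : Set (E n)} {v : E n} {b : Module.Basis (Fin n) ℝ (E n)}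
    (hb : AuxGood P v b) (I : Finset (Fin n)) : faceDim (auxFc P v b I) = I.card := by
  classical
  rw [aux_dim (aux_mem_self hb I) (Set.range (fun i : I => b i))]
  · have h := finrank_span_eq_card (b.linearIndependent.comp (Subtype.val : I → Fin n)
      Subtype.val_injective)
    rw [Fintype.card_coe] at h
    exact h
  · rintro x ⟨hx, h0⟩
    rw [← b.sum_repr (x - v)]
    refine Submodule.sum_mem _ fun i _ => ?_
    by_cases hi : i ∈ I
    · exact Submodule.smul_mem _ _ (Submodule.subset_span ⟨⟨i, hi⟩, rfl⟩)
    · rw [h0 i hi, zero_smul]; exact Submodule.zero_mem _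
  · rintro _ ⟨i, rfl⟩
    exact aux_mem_edge hb I i.2

lemma aux_fc_face {n : ℕ} {P : Set (E n)} {v : E n} {b : Module.Basis (Fin n) ℝ (E n)}
    (hb : AuxGood P v b) (hP : faceDim P = n) (I : Finset (Fin n)) (hI : I.card < n) :
    IsIFace P (auxFc P v b I) I.card := by
  refine ⟨⟨⟨v, aux_mem_self hb I⟩, ?_, aux_fc_exposed hb I⟩, aux_fc_dim hb I⟩
  intro h
  have := aux_fc_dim hb I
  rw [h] at this
  omega

lemma aux_fc_sub {n : ℕ} {P : Set (E n)} {v : E n} {b : Module.Basis (Fin n) ℝ (E n)}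
    (hb : AuxGood P v b) {I J : Finset (Fin n)} (h : auxFc P v b I ⊆ auxFc P v b J) : I ⊆ J := by
  intro i hi
  obtain ⟨c, hc, hm⟩ := aux_mem_edge hb I hi
  by_contra hj
  have := (h hm).2 i hj
  simp at this
  exact hc.ne' this

lemma aux_fc_surj {n : ℕ} {P : Set (E n)} {v : E n} {b : Module.Basis (Fin n) ℝ (E n)}
    (hb : AuxGood P v b) {F : Set (E n)} (hF : IsExposed ℝ P F) (hv : v ∈ F) :
    ∃ I, F = auxFc P v b I := by
  classical
  obtain ⟨g, hg⟩ := hF ⟨v, hv⟩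
  have hgv : ∀ y ∈ P, g y ≤ g v := by
    rw [hg] at hv; exact hv.2
  have hgb : ∀ i, g (b i) ≤ 0 := by
    intro i
    obtain ⟨c, hc, h⟩ := hb.2.1 i
    have := hgv _ h
    simp only [map_add, map_smul, smul_eq_mul] at this
    by_contra hh
    push Not at hh
    have := mul_pos hc hh
    linarith
  have hval : ∀ x, g x - g v = ∑ i, b.repr (x - v) i * g (b i) := by
    intro x
    rw [← map_sub]
    conv_lhs => rw [← b.sum_repr (x - v)]
    simp only [map_sum, map_smul, smul_eq_mul]
  refine ⟨Finset.univ.filter (fun i => g (b i) = 0), ?_⟩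
  rw [hg]
  ext x
  refine and_congr_right fun hx => ?_
  have hterm : ∀ i ∈ Finset.univ, b.repr (x - v) i * g (b i) ≤ 0 := fun i _ =>
    mul_nonpos_of_nonneg_of_nonpos (hb.2.2 x hx i) (hgb i)
  constructor
  · intro h i hi
    have h1 : g x - g v = 0 := by
      have := h v hb.1; have := hgv x hx; linarith
    rw [hval, Finset.sum_eq_zero_iff_of_nonpos hterm] at h1
    have := h1 i (Finset.mem_univ i)
    simp only [Finset.mem_filter, Finset.mem_univ, true_and] at hi
    exact (mul_eq_zero.1 this).resolve_right hi
  · intro h y hy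
    have h1 : g x - g v = 0 := by
      rw [hval]
      refine Finset.sum_eq_zero fun i _ => ?_
      by_cases hi : g (b i) = 0
      · rw [hi, mul_zero]
      · rw [h i (by simp [hi]), zero_mul]
    have := hgv y hy
    linarith

lemma aux_face_hull {n : ℕ} {P F : Set (E n)} (hc : IsCompact P) (hconv : Convex ℝ P)
    (hF : IsExposed ℝ P F) : F = closure (convexHull ℝ (F ∩ Set.extremePoints ℝ P)) := by
  rw [← hF.isExtreme.extremePoints_eq]
  exact (closure_convexHull_extremePoints (hF.isCompact hc) (hF.convex hconv)).symm

lemma aux_faces_finite {n : ℕ} {P : Set (E n)} (hc : IsCompact P) (hconv : Convex ℝ P)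
    (hfin : (Set.extremePoints ℝ P).Finite) (i : ℕ) : (facesOf P i).Finite := by
  apply Set.Finite.of_finite_image (f := fun F => F ∩ Set.extremePoints ℝ P)
  · exact hfin.finite_subsets.subset (by rintro _ ⟨F, _, rfl⟩; exact Set.inter_subset_right)
  · intro F hF G hG h
    rw [aux_face_hull hc hconv hF.1.2.2, aux_face_hull hc hconv hG.1.2.2]
    exact congrArg (fun A => closure (convexHull ℝ A)) h

lemma aux_face_vertex {n : ℕ} {P F : Set (E n)} (hc : IsCompact P)
    (hF : IsExposed ℝ P F) (hne : F.Nonempty) : ∃ v ∈ Set.extremePoints ℝ P, v ∈ F := by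
  obtain ⟨v, hv⟩ := (hF.isCompact hc).extremePoints_nonempty hne
  rw [hF.isExtreme.extremePoints_eq] at hv
  exact ⟨v, hv.2, hv.1⟩

lemma aux_edge_two {n : ℕ} {P F : Set (E n)} (hc : IsCompact P) (hconv : Convex ℝ P)
    (hF : IsIFace P F 1) : ∃ v ∈ Set.extremePoints ℝ P, ∃ w ∈ Set.extremePoints ℝ P,
      v ∈ F ∧ w ∈ F ∧ v ≠ w := by
  obtain ⟨v, hv, hvF⟩ := aux_face_vertex hc hF.1.2.2 hF.1.1
  by_contra hcon
  push Not at hcon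
  have h1 : F ∩ Set.extremePoints ℝ P = {v} := by
    ext w
    constructor
    · rintro ⟨h1, h2⟩
      exact (hcon v hv w h2 hvF h1).symm
    · rintro rfl
      exact ⟨hvF, hv⟩
  have h2 := aux_face_hull hc hconv hF.1.2.2
  rw [h1, convexHull_singleton, closure_singleton] at h2
  have h3 := hF.2
  rw [h2] at h3
  unfold faceDim at h3
  rw [direction_affineSpan, vectorSpan_singleton, finrank_bot] at h3
  omega

lemma aux_min {n : ℕ} {P : Set (E n)} {v : E n} {b : Module.Basis (Fin n) ℝ (E n)}
    (hb : AuxGood P v b) (l : E n →ₗ[ℝ] ℝ) {I : Finset (Fin n)} (hI : ∀ i ∈ I, 0 < l (b i))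
    {x : E n} (hx : x ∈ auxFc P v b I) : l v ≤ l x ∧ (l x = l v → x = v) := by
  have hval : l x - l v = ∑ i, b.repr (x - v) i * l (b i) := by
    rw [← map_sub]
    conv_lhs => rw [← b.sum_repr (x - v)]
    simp only [map_sum, map_smul, smul_eq_mul]
  have hterm : ∀ i ∈ Finset.univ, 0 ≤ b.repr (x - v) i * l (b i) := by
    intro i _
    by_cases hi : i ∈ I
    · exact mul_nonneg (hb.2.2 x hx.1 i) (hI i hi).le
    · rw [hx.2 i hi, zero_mul]
  have hnn := Finset.sum_nonneg hterm
  refine ⟨by linarith, fun h => ?_⟩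
  rw [h, sub_self, eq_comm, Finset.sum_eq_zero_iff_of_nonneg hterm] at hval
  rw [← sub_eq_zero, ← b.sum_repr (x - v)]
  refine Finset.sum_eq_zero fun i _ => ?_
  by_cases hi : i ∈ I
  · rw [(mul_eq_zero.1 (hval i (Finset.mem_univ i))).resolve_right (hI i hi).ne', zero_smul]
  · rw [hx.2 i hi, zero_smul]

lemma aux_count {n : ℕ} (hn : 3 ≤ n) {P : Set (E n)} (hdim : faceDim P = n)
    (V : Finset (E n)) (b : E n → Module.Basis (Fin n) ℝ (E n))
    (hb : ∀ v ∈ V, AuxGood P v (b v)) (E2 : Finset (Set (E n)))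
    (hE2 : ∀ F, F ∈ E2 ↔ IsIFace P F 2) (l : E n →ₗ[ℝ] ℝ) :
    ∑ v ∈ V, ((Finset.univ.filter (fun i => 0 < l (b v i))).card).choose 2 ≤ E2.card := by
  classical
  have h1 : ∑ v ∈ V, ((Finset.univ.filter (fun i => 0 < l (b v i))).card).choose 2 =
      (V.sigma fun v => (Finset.univ.filter (fun i => 0 < l (b v i))).powersetCard 2).card := by
    rw [Finset.card_sigma]
    exact Finset.sum_congr rfl fun v _ => by rw [Finset.card_powersetCard]
  rw [h1]
  apply Finset.card_le_card_of_injOn (fun p => auxFc P p.1 (b p.1) p.2)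
  · rintro ⟨v, I⟩ h
    simp only [Finset.mem_coe, Finset.mem_sigma, Finset.mem_powersetCard] at h
    obtain ⟨hv, hI, hc⟩ := h
    rw [Finset.mem_coe, hE2, ← hc]
    exact aux_fc_face (hb v hv) hdim I (by omega)
  · rintro ⟨v, I⟩ h ⟨w, J⟩ h' heq
    simp only [Finset.mem_coe, Finset.mem_sigma, Finset.mem_powersetCard] at h h' heq
    obtain ⟨hv, hI, hc⟩ := h
    obtain ⟨hw, hJ, hc'⟩ := h'
    have hI' : ∀ i ∈ I, 0 < l (b v i) := fun i hi => by simpa using hI hi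
    have hJ' : ∀ i ∈ J, 0 < l (b w i) := fun i hi => by simpa using hJ hi
    have k1 : w ∈ auxFc P v (b v) I := heq ▸ aux_mem_self (hb w hw) J
    have k2 : v ∈ auxFc P w (b w) J := heq ▸ aux_mem_self (hb v hv) I
    have m1 := aux_min (hb v hv) l hI' k1
    have m2 := aux_min (hb w hw) l hJ' k2
    obtain rfl : w = v := m1.2 (le_antisymm m2.1 m1.1)
    obtain rfl : I = J := Finset.Subset.antisymm (aux_fc_sub (hb w hw) heq.subset)
      (aux_fc_sub (hb w hw) heq.superset)
    rfl

lemma aux_arith {n j k : ℕ} (h : j + k = n) {ε : ℝ} (hε : ε = if Even n then 0 else 1) :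
    ((n : ℝ) - ε) * (n - 2 + ε) / 4 ≤ (j.choose 2 : ℝ) + (k.choose 2 : ℝ) := by
  rw [Nat.cast_choose_two, Nat.cast_choose_two]
  have hn : (n : ℝ) = j + k := by rw [← h]; push_cast; ring
  have hpar : ε ≤ ((j : ℝ) - k) ^ 2 := by
    rw [hε]
    split_ifs with he
    · positivity
    · have hne : (j : ℤ) - k ≠ 0 := by
        intro h0
        apply he
        have : j = k := by omega
        exact ⟨k, by omega⟩
      have : (1 : ℤ) ≤ ((j : ℤ) - k) ^ 2 := by
        have := sq_nonneg ((j : ℤ) - k)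
        have : ((j : ℤ) - k) ^ 2 ≠ 0 := pow_ne_zero 2 hne
        omega
      exact_mod_cast this
  have hεε : ε * ε = ε := by rw [hε]; split_ifs <;> simp
  rw [hn]
  nlinarith

lemma aux_final {n : ℕ} (hn : 3 ≤ n) {ε X a1 a2 V : ℝ} (hε : ε = if Even n then 0 else 1)
    (hX : X ≤ (n - 1) * a1) (h1 : 2 * a1 ≤ n * V)
    (h2 : V * (((n : ℝ) - ε) * (n - 2 + ε) / 4) < 2 * a2) (hV : 0 ≤ V) :
    1 / a2 * X < 4 * ((n : ℝ) - 1 + ε) / ((n : ℝ) - 2 + ε) := by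
  have hn' : (3 : ℝ) ≤ n := by exact_mod_cast hn
  have hε0 : 0 ≤ ε := by rw [hε]; split_ifs <;> simp
  have hε1 : ε ≤ 1 := by rw [hε]; split_ifs <;> simp
  have hεε : ε * ε = ε := by rw [hε]; split_ifs <;> simp
  have hp : 0 < (n : ℝ) - 2 + ε := by linarith
  have hq : 0 < (n : ℝ) - 1 + ε := by linarith
  have ha2 : 0 < a2 := by
    have : 0 ≤ V * (((n : ℝ) - ε) * (n - 2 + ε) / 4) := by
      have : 0 ≤ (n : ℝ) - ε := by linarith
      positivity
    linarith
  rw [one_div, inv_mul_eq_div, div_lt_div_iff₀ ha2 hp]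
  have s1 : X ≤ (n - 1) * (n * V / 2) := hX.trans
    (mul_le_mul_of_nonneg_left (by linarith) (by linarith))
  have s2 := mul_le_mul_of_nonneg_right s1 hp.le
  have s3 := mul_lt_mul_of_pos_left h2 hq
  have e : ((n : ℝ) - 1 + ε) * (n - ε) = n * (n - 1) := by
    linear_combination -hεε
  have e2 : ((n : ℝ) - 1 + ε) * (V * (((n : ℝ) - ε) * (n - 2 + ε) / 4)) =
      n * (n - 1) * V * (n - 2 + ε) / 4 := by
    rw [← e]; ring
  rw [e2] at s3
  linarith

/-- **Inequality (5).** Nikulin's estimate for `i = 1`, `k = 2`: the average number of edges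
of a 2-face of an `n`-dimensional simple polytope (`n ≥ 3`) is less than
`4(n-1+ε)/(n-2+ε)`, where `ε = 0` for even `n` and `ε = 1` for odd `n`. -/
theorem avg_edges_of_two_face_lt (n : ℕ) (hn : 3 ≤ n) (P : Set (E n))
    (hP : IsSimplePolytope n P) (ε : ℝ) (hε : ε = if Even n then 0 else 1) :
    avgFaces P 2 1 < 4 * ((n : ℝ) - 1 + ε) / ((n : ℝ) - 2 + ε) := by
  classical
  have hdim : faceDim P = n := aux_dimP hP.2.1
  obtain ⟨S, hS, hPS⟩ := hP.1
  have hcomp : IsCompact P := by rw [hPS]; exact S.finite_toSet.isCompact_convexHull (𝕜 := ℝ)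
  have hconv : Convex ℝ P := by rw [hPS]; exact convex_convexHull ℝ _
  have hPne : P.Nonempty := by
    rw [hPS]; exact (Finset.coe_nonempty.2 hS).convexHull
  have hext : (Set.extremePoints ℝ P).Finite := by
    rw [hPS]; exact S.finite_toSet.subset extremePoints_convexHull_subset
  have hhull : convexHull ℝ (Set.extremePoints ℝ P) = P := by
    rw [hPS]; exact aux_hull_ext S
  have hf1 := aux_faces_finite hcomp hconv hext 1
  have hf2 := aux_faces_finite hcomp hconv hext 2
  let V := hext.toFinset
  let E1 := hf1.toFinset
  let E2 := hf2.toFinset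
  have hV : ∀ v, v ∈ V ↔ v ∈ Set.extremePoints ℝ P := fun v => hext.mem_toFinset
  have hE1 : ∀ F, F ∈ E1 ↔ IsIFace P F 1 := fun F => hf1.mem_toFinset
  have hE2 : ∀ F, F ∈ E2 ↔ IsIFace P F 2 := fun F => hf2.mem_toFinset
  have hbex : ∀ v, ∃ b : Module.Basis (Fin n) ℝ (E n), v ∈ V → AuxGood P v b := by
    intro v
    by_cases hv : v ∈ V
    · obtain ⟨b, h1, h2⟩ := aux_basis hn hP ((hV v).1 hv)
      exact ⟨b, fun _ => ⟨((hV v).1 hv).1, h1, h2⟩⟩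
    · exact ⟨(EuclideanSpace.basisFun (Fin n) ℝ).toBasis, fun h => absurd h hv⟩
  choose b hb using hbex
  -- (A)
  have hA : ∑ F ∈ E2, (E1.filter (fun e => e ⊆ F)).card ≤ (n - 1) * E1.card := by
    have hsw := Finset.sum_card_bipartiteAbove_eq_sum_card_bipartiteBelow
      (s := E2) (t := E1) (fun F e => e ⊆ F)
    simp only [Finset.bipartiteAbove, Finset.bipartiteBelow] at hsw
    rw [hsw, mul_comm, ← smul_eq_mul]
    apply Finset.sum_le_card_nsmul
    intro e he
    have he' := (hE1 e).1 he
    obtain ⟨v, hv, hve⟩ := aux_face_vertex hcomp he'.1.2.2 he'.1.1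
    have hbv := hb v ((hV v).2 hv)
    obtain ⟨I, hI⟩ := aux_fc_surj hbv he'.1.2.2 hve
    have hI1 : I.card = 1 := by rw [← aux_fc_dim hbv I, ← hI]; exact he'.2
    obtain ⟨i, rfl⟩ := Finset.card_eq_one.1 hI1
    have hsub : E2.filter (fun F => e ⊆ F) ⊆
        (Finset.univ.erase i).image (fun j => auxFc P v (b v) {i, j}) := by
      intro F hF
      rw [Finset.mem_filter] at hF
      have hF' := (hE2 F).1 hF.1
      obtain ⟨J, hJ⟩ := aux_fc_surj hbv hF'.1.2.2 (hF.2 hve)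
      have hJ2 : J.card = 2 := by rw [← aux_fc_dim hbv J, ← hJ]; exact hF'.2
      have hiJ : i ∈ J := by
        have h := hF.2
        rw [hI, hJ] at h
        exact aux_fc_sub hbv h (Finset.mem_singleton_self i)
      have h1 : (J.erase i).card = 1 := by rw [Finset.card_erase_of_mem hiJ, hJ2]
      obtain ⟨j, hj⟩ := Finset.card_eq_one.1 h1
      refine Finset.mem_image.2 ⟨j, ?_, ?_⟩
      · have : j ∈ J.erase i := by rw [hj]; exact Finset.mem_singleton_self j
        exact Finset.mem_erase.2 ⟨(Finset.mem_erase.1 this).1, Finset.mem_univ j⟩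
      · rw [hJ, ← Finset.insert_erase hiJ, hj]
    refine (Finset.card_le_card hsub).trans (Finset.card_image_le.trans ?_)
    rw [Finset.card_erase_of_mem (Finset.mem_univ i), Finset.card_univ, Fintype.card_fin]
  -- (B)
  have hB : 2 * E1.card ≤ n * V.card := by
    have hsw := Finset.sum_card_bipartiteAbove_eq_sum_card_bipartiteBelow
      (s := E1) (t := V) (fun e v => v ∈ e)
    simp only [Finset.bipartiteAbove, Finset.bipartiteBelow] at hsw
    have hlow : E1.card • 2 ≤ ∑ e ∈ E1, (V.filter (fun v => v ∈ e)).card := by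
      apply Finset.card_nsmul_le_sum
      intro e he
      obtain ⟨v, hv, w, hw, hve, hwe, hne⟩ := aux_edge_two hcomp hconv ((hE1 e).1 he)
      exact Finset.one_lt_card.2 ⟨v, Finset.mem_filter.2 ⟨(hV v).2 hv, hve⟩, w,
        Finset.mem_filter.2 ⟨(hV w).2 hw, hwe⟩, hne⟩
    have hup : ∑ v ∈ V, (E1.filter (fun e => v ∈ e)).card ≤ V.card • n := by
      apply Finset.sum_le_card_nsmul
      intro v hv
      have hsub : E1.filter (fun e => v ∈ e) ⊆
          Finset.univ.image (fun i => auxFc P v (b v) {i}) := by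
        intro e he
        rw [Finset.mem_filter] at he
        have he' := (hE1 e).1 he.1
        obtain ⟨I, hI⟩ := aux_fc_surj (hb v hv) he'.1.2.2 he.2
        have hI1 : I.card = 1 := by rw [← aux_fc_dim (hb v hv) I, ← hI]; exact he'.2
        obtain ⟨i, rfl⟩ := Finset.card_eq_one.1 hI1
        exact Finset.mem_image.2 ⟨i, Finset.mem_univ i, hI.symm⟩
      refine (Finset.card_le_card hsub).trans (Finset.card_image_le.trans ?_)
      rw [Finset.card_univ, Fintype.card_fin]
    rw [hsw] at hlow
    have := hlow.trans hup
    simp only [smul_eq_mul] at this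
    linarith
  -- generic functional
  obtain ⟨l, hl⟩ := Module.exists_dual_forall_apply_ne_zero (K := ℝ)
    (fun p : V × Fin n => b p.1 p.2) (fun p => (b p.1).ne_zero p.2)
  have hC1 := aux_count hn hdim V b hb E2 hE2 l
  have hC2 := aux_count hn hdim V b hb E2 hE2 (-l)
  have hVne : V.Nonempty := by
    obtain ⟨v, hv⟩ := hcomp.extremePoints_nonempty hPne
    exact ⟨v, (hV v).2 hv⟩
  obtain ⟨v0, hv0, hmin⟩ := Finset.exists_min_image V l hVne
  have hminP : ∀ x ∈ P, l v0 ≤ l x := by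
    intro x hx
    rw [← hhull] at hx
    have : Convex ℝ {x : E n | l v0 ≤ l x} := convex_halfSpace_ge l.isLinear _
    exact convexHull_min (fun y hy => hmin y ((hV y).2 hy)) this hx
  let j : E n → ℕ := fun v => (Finset.univ.filter (fun i => 0 < l (b v i))).card
  let k : E n → ℕ := fun v => (Finset.univ.filter (fun i => 0 < (-l) (b v i))).card
  have hjk : ∀ v ∈ V, j v + k v = n := by
    intro v hv
    have h1 : (Finset.univ.filter (fun i => 0 < (-l) (b v i))) =
        Finset.univ.filter (fun i => ¬ 0 < l (b v i)) := by
      apply Finset.filter_congr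
      intro i _
      have := hl (⟨v, hv⟩, i)
      simp only [LinearMap.neg_apply, Left.neg_pos_iff, not_lt]
      exact ⟨le_of_lt, fun h => lt_of_le_of_ne h this⟩
    simp only [j, k]
    rw [h1, Finset.card_filter_add_card_filter_not, Finset.card_univ, Fintype.card_fin]
  have hj0 : j v0 = n := by
    simp only [j]
    rw [Finset.filter_true_of_mem, Finset.card_univ, Fintype.card_fin]
    intro i _
    obtain ⟨c, hc, h⟩ := (hb v0 hv0).2.1 i
    have h1 := hminP _ h
    simp only [map_add, map_smul, smul_eq_mul] at h1
    have h2 : 0 ≤ l (b v0 i) := by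
      by_contra hh
      push Not at hh
      have := mul_neg_of_pos_of_neg hc hh
      linarith
    exact lt_of_le_of_ne h2 (Ne.symm (hl (⟨v0, hv0⟩, i)))
  have hn' : (3 : ℝ) ≤ n := by exact_mod_cast hn
  have hk0 : k v0 = 0 := by have := hjk v0 hv0; omega
  have hstrict : (V.card : ℝ) * (((n : ℝ) - ε) * (n - 2 + ε) / 4) < 2 * (E2.card : ℝ) := by
    have h1 : ∑ v ∈ V, (((n : ℝ) - ε) * (n - 2 + ε) / 4) <
        ∑ v ∈ V, (((j v).choose 2 : ℝ) + ((k v).choose 2 : ℝ)) := by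
      apply Finset.sum_lt_sum (fun v hv => aux_arith (hjk v hv) hε)
      refine ⟨v0, hv0, ?_⟩
      rw [hj0, hk0, Nat.cast_choose_two, Nat.cast_choose_two]
      have hεε : ε * ε = ε := by rw [hε]; split_ifs <;> simp
      have hε1 : ε ≤ 1 := by rw [hε]; split_ifs <;> simp
      push_cast
      nlinarith
    rw [Finset.sum_const, nsmul_eq_mul, Finset.sum_add_distrib] at h1
    have h2 : (∑ v ∈ V, ((j v).choose 2 : ℝ)) ≤ E2.card := by exact_mod_cast hC1
    have h3 : (∑ v ∈ V, ((k v).choose 2 : ℝ)) ≤ E2.card := by exact_mod_cast hC2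
    linarith
  have hα2 : nFaces P 2 = E2.card := Set.ncard_eq_toFinset_card _ hf2
  have hin : ∀ F, nFacesIn P F 1 = (E1.filter (fun e => e ⊆ F)).card := by
    intro F
    unfold nFacesIn
    rw [← Set.ncard_coe_finset]
    congr 1
    ext e
    simp [hE1]
  unfold avgFaces
  rw [hα2, finsum_mem_eq_finite_toFinset_sum _ hf2]
  refine aux_final (V := V.card) (a1 := E1.card) hn hε ?_ ?_ hstrict (Nat.cast_nonneg _)
  · have h1 : (n : ℝ) - 1 = ((n - 1 : ℕ) : ℝ) := by
      rw [Nat.cast_sub (by omega), Nat.cast_one]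
    rw [h1]
    simp only [hin]
    exact_mod_cast hA
  · exact_mod_cast hB
end

section
/- (Lemma 7.) Let n ≥ 3, let P be an n-dimensional simple polytope in ℝⁿ, and let l be the number of vertices of P. Then l/α₂ = (2/(n(n−1))) · α₂^{(1)} as real numbers. -/
open scoped BigOperators

section LinAlg
open scoped InnerProductSpace
set_option linter.unusedSectionVars false
variable {V : Type*} [NormedAddCommGroup V] [InnerProductSpace ℝ V] [FiniteDimensional ℝ V]

def zs (T : Finset V) (a : V) : Set V := {t | t ∈ T ∧ ⟪a, t⟫_ℝ = 0}

lemma push_aux (T : Finset V) (p : V)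
    (hp : ∀ a : V, (∀ t ∈ T, ⟪a, t⟫_ℝ ≤ 0) → a ≠ 0 → ⟪a, p⟫_ℝ < 0)
    (a m : V) (ha : ∀ t ∈ T, ⟪a, t⟫_ℝ ≤ 0) (hm : m ≠ 0) (hmp : ⟪m, p⟫_ℝ = 0)
    (hmz : ∀ t ∈ T, ⟪a, t⟫_ℝ = 0 → ⟪m, t⟫_ℝ = 0) :
    ∃ r : ℝ, 0 < r ∧ (∀ t ∈ T, ⟪a + r • m, t⟫_ℝ ≤ 0) ∧
      (T.filter (fun t => ⟪a + r • m, t⟫_ℝ < 0)).card < (T.filter (fun t => ⟪a, t⟫_ℝ < 0)).card := by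
  have hne : (T.filter (fun t => 0 < ⟪m, t⟫_ℝ)).Nonempty := by
    by_contra h
    rw [Finset.not_nonempty_iff_eq_empty, Finset.filter_eq_empty_iff] at h
    have := hp m (fun t ht => not_lt.1 (h ht)) hm
    linarith
  obtain ⟨s, hs, hmin⟩ := Finset.exists_min_image _ (fun t => -⟪a, t⟫_ℝ / ⟪m, t⟫_ℝ) hne
  rw [Finset.mem_filter] at hs
  have has : ⟪a, s⟫_ℝ < 0 := by
    refine lt_of_le_of_ne (ha s hs.1) (fun h => ?_)
    have := hmz s hs.1 h
    linarith [hs.2]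
  have key : ∀ t ∈ T, ⟪a + (-⟪a, s⟫_ℝ / ⟪m, s⟫_ℝ) • m, t⟫_ℝ ≤ 0 := by
    intro t ht
    rw [inner_add_left, real_inner_smul_left]
    by_cases h : 0 < ⟪m, t⟫_ℝ
    · have := hmin t (by simp [ht, h])
      rw [le_div_iff₀ h] at this
      linarith
    · have h1 : 0 ≤ -⟪a, s⟫_ℝ / ⟪m, s⟫_ℝ := div_nonneg (by linarith) hs.2.le
      have := mul_nonneg h1 (neg_nonneg.2 (not_lt.1 h))
      linarith [ha t ht]
  refine ⟨-⟪a, s⟫_ℝ / ⟪m, s⟫_ℝ, div_pos (by linarith) hs.2, key, ?_⟩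
  apply Finset.card_lt_card
  rw [Finset.ssubset_iff_of_subset]
  · refine ⟨s, by simp [hs.1, has], ?_⟩
    have := hs.2.ne'
    simp only [Finset.mem_filter, not_and, not_lt, inner_add_left, real_inner_smul_left]
    intro _
    field_simp
    linarith
  · intro t ht
    rw [Finset.mem_filter] at ht ⊢
    refine ⟨ht.1, lt_of_le_of_ne (ha t ht.1) (fun h => ?_)⟩
    have h2 := ht.2
    rw [inner_add_left, real_inner_smul_left, h, hmz t ht.1 h] at h2
    simp at h2

lemma mem_span_top_zero (T : Finset V) (hT : Submodule.span ℝ (T : Set V) = ⊤) (a : V)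
    (h : ∀ t ∈ T, ⟪a, t⟫_ℝ = 0) : a = 0 := by
  have : a ∈ (Submodule.span ℝ (T : Set V))ᗮ := by
    rw [Submodule.mem_orthogonal']
    intro u hu
    induction hu using Submodule.span_induction with
    | mem x hx => exact h x hx
    | zero => simp
    | add x y _ _ hx hy => rw [inner_add_right, hx, hy, add_zero]
    | smul r x _ hx => rw [real_inner_smul_right, hx, mul_zero]
  simpa [hT] using this

lemma cone_gen (T : Finset V) (hT : Submodule.span ℝ (T : Set V) = ⊤)
    (C : V → Prop) (h0 : C 0) (hadd : ∀ a b, C a → C b → C (a + b))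
    (hsmul : ∀ (r : ℝ) a, 0 ≤ r → C a → C (r • a))
    (hfac : ∀ a : V, (∀ t ∈ T, ⟪a, t⟫_ℝ ≤ 0) → a ≠ 0 →
      Module.finrank ℝ V ≤ Module.finrank ℝ (Submodule.span ℝ (zs T a)) + 1 → C a) :
    ∀ a : V, (∀ t ∈ T, ⟪a, t⟫_ℝ ≤ 0) → C a := by
  have hp : ∀ a : V, (∀ t ∈ T, ⟪a, t⟫_ℝ ≤ 0) → a ≠ 0 → ⟪a, ∑ t ∈ T, t⟫_ℝ < 0 := by
    intro a ha hne
    rw [inner_sum]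
    refine lt_of_le_of_ne (Finset.sum_nonpos ha) (fun h => hne ?_)
    rw [Finset.sum_eq_zero_iff_of_nonpos ha] at h
    exact mem_span_top_zero T hT a h
  suffices H : ∀ k : ℕ, ∀ a : V, (T.filter (fun t => ⟪a, t⟫_ℝ < 0)).card = k →
      (∀ t ∈ T, ⟪a, t⟫_ℝ ≤ 0) → C a from fun a ha => H _ a rfl ha
  intro k
  induction k using Nat.strong_induction_on with
  | _ k ih =>
  intro a hk ha
  by_cases ha0 : a = 0
  · rw [ha0]; exact h0
  by_cases hd : Module.finrank ℝ V ≤ Module.finrank ℝ (Submodule.span ℝ (zs T a)) + 1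
  · exact hfac a ha ha0 hd
  set p := ∑ t ∈ T, t with hpdef
  have hlt : Module.finrank ℝ (Submodule.span ℝ (zs T a) ⊔ Submodule.span ℝ {p} : Submodule ℝ V)
      < Module.finrank ℝ V := by
    have h1 := Submodule.finrank_add_le_finrank_add_finrank (Submodule.span ℝ (zs T a))
      (Submodule.span ℝ {p})
    have h2 : Module.finrank ℝ (Submodule.span ℝ ({p} : Set V)) ≤ 1 := by
      simpa using finrank_span_le_card (R := ℝ) ({p} : Set V)
    omega
  have hbot : (Submodule.span ℝ (zs T a) ⊔ Submodule.span ℝ {p} : Submodule ℝ V)ᗮ ≠ ⊥ := by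
    intro h
    rw [Submodule.orthogonal_eq_bot_iff] at h
    rw [h, finrank_top] at hlt
    exact lt_irrefl _ hlt
  obtain ⟨m, hm, hm0⟩ := Submodule.exists_mem_ne_zero_of_ne_bot hbot
  rw [Submodule.mem_orthogonal'] at hm
  have hmp : ⟪m, p⟫_ℝ = 0 := hm p (Submodule.mem_sup_right (Submodule.mem_span_singleton_self p))
  have hmz : ∀ t ∈ T, ⟪a, t⟫_ℝ = 0 → ⟪m, t⟫_ℝ = 0 := fun t ht h =>
    hm t (Submodule.mem_sup_left (Submodule.subset_span ⟨ht, h⟩))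
  obtain ⟨r, hr, h1, h2⟩ := push_aux T p hp a m ha hm0 hmp hmz
  obtain ⟨r', hr', h1', h2'⟩ := push_aux T p hp a (-m) ha (by simpa using hm0)
    (by simp [hmp]) (fun t ht h => by simp [hmz t ht h])
  have c1 := ih _ (hk ▸ h2) _ rfl h1
  have c2 := ih _ (hk ▸ h2') _ rfl h1'
  have := hadd _ _ (hsmul (r' / (r + r')) _ (by positivity) c1)
    (hsmul (r / (r + r')) _ (by positivity) c2)
  convert this using 1
  match_scalars
  · field_simp; ring
  · field_simp; ring

lemma bigK (T : Finset V) (a m : V) (ha : ∀ t ∈ T, ⟪a, t⟫_ℝ ≤ 0)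
    (hmz : ∀ t ∈ T, ⟪a, t⟫_ℝ = 0 → ⟪m, t⟫_ℝ = 0) :
    ∃ K : ℝ, ∀ t ∈ T, ⟪K • a + m, t⟫_ℝ ≤ 0 ∧ ⟪K • a - m, t⟫_ℝ ≤ 0 := by
  refine ⟨∑ t ∈ T, |⟪m, t⟫_ℝ| / (-⟪a, t⟫_ℝ), fun t ht => ?_⟩
  have h1 : |⟪m, t⟫_ℝ| / (-⟪a, t⟫_ℝ) ≤ ∑ t ∈ T, |⟪m, t⟫_ℝ| / (-⟪a, t⟫_ℝ) :=
    Finset.single_le_sum (f := fun t => |⟪m, t⟫_ℝ| / (-⟪a, t⟫_ℝ))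
      (fun i hi => div_nonneg (abs_nonneg _) (by linarith [ha i hi])) ht
  generalize ∑ t ∈ T, |⟪m, t⟫_ℝ| / (-⟪a, t⟫_ℝ) = K at h1
  rw [inner_add_left, inner_sub_left, real_inner_smul_left]
  rcases (ha t ht).lt_or_eq with h | h
  · rw [div_le_iff₀ (by linarith)] at h1
    constructor <;> linarith [le_abs_self ⟪m, t⟫_ℝ, neg_abs_le ⟪m, t⟫_ℝ]
  · simp [h, hmz t ht h]

lemma simplicial {ι : Type*} [Fintype ι] (T : Finset V) (l : ι → V) (hl : LinearIndependent ℝ l)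
    (hN : ∀ i, ∀ t ∈ T, ⟪l i, t⟫_ℝ ≤ 0)
    (hgen : ∀ a : V, (∀ t ∈ T, ⟪a, t⟫_ℝ ≤ 0) → ∃ c : ι → ℝ, (∀ i, 0 ≤ c i) ∧ a = ∑ i, c i • l i)
    (c : ι → ℝ) (hc : ∀ i, 0 ≤ c i) :
    (Submodule.span ℝ (zs T (∑ i, c i • l i)))ᗮ = Submodule.span ℝ (l '' {i | c i ≠ 0}) := by
  have hcN : ∀ t ∈ T, ∀ i ∈ Finset.univ, c i * ⟪l i, t⟫_ℝ ≤ 0 := fun t ht i _ =>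
    mul_nonpos_of_nonneg_of_nonpos (hc i) (hN i t ht)
  have hexp : ∀ t, ⟪∑ i, c i • l i, t⟫_ℝ = ∑ i, c i * ⟪l i, t⟫_ℝ := fun t => by
    simp [sum_inner, real_inner_smul_left]
  apply le_antisymm
  · intro m hm
    rw [Submodule.mem_orthogonal'] at hm
    obtain ⟨K, hK⟩ := bigK T (∑ i, c i • l i) m
      (fun t ht => by rw [hexp]; exact Finset.sum_nonpos (hcN t ht))
      (fun t ht h => hm t (Submodule.subset_span ⟨ht, h⟩))
    obtain ⟨d, hd, hd'⟩ := hgen _ (fun t ht => (hK t ht).1)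
    obtain ⟨e, he, he'⟩ := hgen _ (fun t ht => (hK t ht).2)
    have hsum : ∑ i, (2 * K * c i - d i - e i) • l i = 0 := by
      have : ∑ i, (2 * K * c i - d i - e i) • l i
        = (2 * K) • (∑ i, c i • l i) - ∑ i, d i • l i - ∑ i, e i • l i := by
        simp only [sub_smul, Finset.sum_sub_distrib, mul_smul, Finset.smul_sum]
      rw [this, ← hd', ← he']
      module
    have hz := Fintype.linearIndependent_iff.1 hl _ hsum
    have hmeq : m = ∑ i, (d i - K * c i) • l i := by
      have : ∑ i, (d i - K * c i) • l i = ∑ i, d i • l i - K • (∑ i, c i • l i) := by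
        simp only [sub_smul, Finset.sum_sub_distrib, mul_smul, Finset.smul_sum]
      rw [this, ← hd']
      module
    rw [hmeq]
    apply Submodule.sum_mem
    intro i _
    by_cases h : c i = 0
    · have := hz i
      rw [h] at this
      have : d i = 0 := by linarith [hd i, he i]
      simp [this, h]
    · exact Submodule.smul_mem _ _ (Submodule.subset_span ⟨i, h, rfl⟩)
  · rw [Submodule.span_le]
    rintro _ ⟨i, hi, rfl⟩
    rw [SetLike.mem_coe, Submodule.mem_orthogonal']
    intro u hu
    induction hu using Submodule.span_induction with
    | mem t ht =>
      have := ht.2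
      rw [hexp, Finset.sum_eq_zero_iff_of_nonpos (hcN t ht.1)] at this
      exact (mul_eq_zero.1 (this i (Finset.mem_univ i))).resolve_left hi
    | zero => simp
    | add x y _ _ hx hy => rw [inner_add_right, hx, hy, add_zero]
    | smul r x _ hx => rw [real_inner_smul_right, hx, mul_zero]

end LinAlg

section Poly
open scoped InnerProductSpace

lemma poly_compact {n : ℕ} {P : Set (E n)} (h : IsPolytope P) : IsCompact P := by
  obtain ⟨S, _, rfl⟩ := h
  exact S.finite_toSet.isCompact_convexHull (𝕜 := ℝ)

lemma poly_convex {n : ℕ} {P : Set (E n)} (h : IsPolytope P) : Convex ℝ P := by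
  obtain ⟨S, _, rfl⟩ := h
  exact convex_convexHull _ _

lemma finite_faces {n : ℕ} {P : Set (E n)} (h : IsPolytope P) : {F | IsFace P F}.Finite := by
  have hc := poly_compact h
  have hv := poly_convex h
  obtain ⟨S, _, hS⟩ := h
  apply Set.Finite.of_finite_image (f := fun F : Set (E n) => F.extremePoints ℝ)
  · apply (S.finite_toSet.powerset).subset
    rintro _ ⟨F, hF, rfl⟩
    refine (hF.2.2.isExtreme.extremePoints_subset_extremePoints).trans ?_
    rw [hS]
    exact extremePoints_convexHull_subset (𝕜 := ℝ)
  · intro F hF G hG hFG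
    rw [← closure_convexHull_extremePoints (hF.2.2.isCompact hc) (hF.2.2.convex hv),
      ← closure_convexHull_extremePoints (hG.2.2.isCompact hc) (hG.2.2.convex hv)]
    simp only at hFG
    rw [hFG]

lemma faceDim_eq {n : ℕ} (F : Set (E n)) : faceDim F = Module.finrank ℝ (vectorSpan ℝ F) := by
  rw [faceDim, direction_affineSpan]

lemma extreme_exposed {n : ℕ} {P : Set (E n)} (h : IsPolytope P) {p : E n}
    (hp : p ∈ P.extremePoints ℝ) : IsExposed ℝ P {p} := by
  have hv := poly_convex h
  obtain ⟨S, _, hS⟩ := h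
  have h1 := (hv.mem_extremePoints_iff_mem_sdiff_convexHull_sdiff.1 hp).2
  have h2 : p ∉ convexHull ℝ ((S : Set (E n)) \ {p}) := fun hh => h1 (convexHull_mono
    (Set.sdiff_subset_sdiff_left (hS ▸ subset_convexHull ℝ (S : Set (E n)))) hh)
  have hcl : IsClosed (convexHull ℝ ((S : Set (E n)) \ {p})) :=
    (S.finite_toSet.subset Set.sdiff_subset).isClosed_convexHull (𝕜 := ℝ)
  obtain ⟨f, u, hfu, hfp⟩ := geometric_hahn_banach_closed_point (convex_convexHull ℝ _) hcl h2
  have hle : ∀ y ∈ P, f y ≤ f p := by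
    intro y hy
    rw [hS] at hy
    have : convexHull ℝ (S : Set (E n)) ⊆ {y | f y ≤ f p} := by
      apply convexHull_min
      · intro s hs
        by_cases hsp : s = p
        · simp [hsp]
        · exact ((hfu s (subset_convexHull ℝ _ ⟨hs, hsp⟩)).trans hfp).le
      · exact convex_halfSpace_le f.isLinear _
    exact this hy
  -- the exposed set's extreme points are in S and attain the max, hence equal p
  have hex : IsExposed ℝ P (f.toExposed P) := ContinuousLinearMap.toExposed.isExposed
  have hcP : IsCompact P := by rw [hS]; exact S.finite_toSet.isCompact_convexHull (𝕜 := ℝ)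
  have hsub : (f.toExposed P).extremePoints ℝ ⊆ {p} := by
    intro x hx
    have hxS : x ∈ (S : Set (E n)) := by
      have := hex.isExtreme.extremePoints_subset_extremePoints hx
      rw [hS] at this
      exact extremePoints_convexHull_subset (𝕜 := ℝ) this
    by_contra hxp
    have h3 := (hfu x (subset_convexHull ℝ _ ⟨hxS, hxp⟩)).trans hfp
    have h4 := hx.1.2 p hp.1
    linarith
  have heq : f.toExposed P = {p} := by
    apply Set.Subset.antisymm
    · rw [← closure_convexHull_extremePoints (hex.isCompact hcP) (hex.convex hv)]
      apply closure_minimal _ isClosed_singleton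
      exact convexHull_min hsub (convex_singleton p)
    · rintro _ rfl
      exact ⟨hp.1, hle⟩
  rw [← heq]
  exact hex

lemma zero_face_iff {n : ℕ} (hn : 3 ≤ n) {P : Set (E n)} (h : IsPolytope P)
    (hspan : affineSpan ℝ P = ⊤) (G : Set (E n)) :
    IsIFace P G 0 ↔ ∃ p ∈ P.extremePoints ℝ, G = {p} := by
  constructor
  · rintro ⟨⟨hne, _, hex⟩, hd⟩
    obtain ⟨p, hp⟩ := hne
    have hG : G = {p} := by
      rw [faceDim_eq, Submodule.finrank_eq_zero] at hd
      exact Set.Subsingleton.eq_singleton_of_mem ((vectorSpan_eq_bot_iff_subsingleton ℝ).1 hd) hp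
    subst hG
    exact ⟨p, isExtreme_singleton.1 hex.isExtreme, rfl⟩
  · rintro ⟨p, hp, rfl⟩
    refine ⟨⟨Set.singleton_nonempty p, ?_, extreme_exposed h hp⟩, ?_⟩
    · intro hpP
      have h1 : vectorSpan ℝ P = ⊤ := by
        rw [← direction_affineSpan, hspan, AffineSubspace.direction_top]
      rw [← hpP, vectorSpan_singleton] at h1
      have h2 : Module.finrank ℝ (⊥ : Submodule ℝ (E n)) = n := by
        rw [h1, finrank_top]; simp
      simp at h2
      omega
    · rw [faceDim_eq, vectorSpan_singleton]; simp

lemma edge_ends {n : ℕ} (hn : 3 ≤ n) {P : Set (E n)} (h : IsPolytope P)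
    (hspan : affineSpan ℝ P = ⊤) (e : Set (E n)) (he : IsIFace P e 1) :
    {G : Set (E n) | IsIFace P G 0 ∧ G ⊆ e}.ncard = 2 := by
  obtain ⟨⟨hne, _, hex⟩, hd⟩ := he
  have hce := hex.isCompact (poly_compact h)
  have hve := hex.convex (poly_convex h)
  have hKM := closure_convexHull_extremePoints hce hve
  obtain ⟨p, hp⟩ := hce.extremePoints_nonempty hne
  have : ∃ q ∈ e.extremePoints ℝ, p ≠ q := by
    by_contra! hcon
    have h1 : e ⊆ {p} := by
      rw [← hKM]
      apply closure_minimal _ isClosed_singleton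
      exact convexHull_min (fun q hq => (hcon q hq).symm) (convex_singleton p)
    have h2 : vectorSpan ℝ e = ⊥ := (vectorSpan_eq_bot_iff_subsingleton ℝ).2 
      (Set.subsingleton_singleton.anti h1)
    rw [faceDim_eq, h2] at hd
    simp at hd
  obtain ⟨q, hq, hpq⟩ := this
  have hcol : Collinear ℝ e := by
    rw [collinear_iff_finrank_le_one, ← faceDim_eq, hd]
  have key : ∀ r ∈ e.extremePoints ℝ, r = p ∨ r = q := by
    intro r hr
    have hc : Collinear ℝ {p, q, r} := hcol.subset (by
      rintro x (rfl | rfl | rfl)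
      exacts [hp.1, hq.1, hr.1])
    rw [mem_extremePoints_iff_forall_segment] at hp hq hr
    rcases hc.wbtw_or_wbtw_or_wbtw with hw | hw | hw
    · have := hq.2 p hp.1 r hr.1 hw.mem_segment
      rcases this with h | h
      · exact absurd h hpq
      · exact Or.inr h
    · have := hr.2 q hq.1 p hp.1 hw.mem_segment
      rcases this with h | h
      · exact Or.inr h.symm
      · exact Or.inl h.symm
    · have := hp.2 r hr.1 q hq.1 hw.mem_segment
      rcases this with h | h
      · exact Or.inl h
      · exact absurd h.symm hpq
  have hset : {G : Set (E n) | IsIFace P G 0 ∧ G ⊆ e} = {{p}, {q}} := by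
    have hexe := hex.isExtreme.extremePoints_eq
    ext G
    simp only [Set.mem_ofPred_eq, Set.mem_insert_iff, Set.mem_singleton_iff,
      zero_face_iff hn h hspan]
    constructor
    · rintro ⟨⟨r, hr, rfl⟩, hre⟩
      have : r ∈ e.extremePoints ℝ := by
        rw [hexe]; exact ⟨hre rfl, hr⟩
      rcases key r this with rfl | rfl <;> simp
    · rw [hexe] at hp hq
      rintro (rfl | rfl)
      · exact ⟨⟨p, hp.2, rfl⟩, by simpa using hp.1⟩
      · exact ⟨⟨q, hq.2, rfl⟩, by simpa using hq.1⟩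
  rw [hset, Set.ncard_pair]
  simpa using hpq

end Poly

section Vert
open scoped InnerProductSpace

def Fa {n : ℕ} (P : Set (E n)) (v a : E n) : Set (E n) := {x | x ∈ P ∧ ⟪a, x - v⟫_ℝ = 0}

lemma zs_orth {V : Type*} [NormedAddCommGroup V] [InnerProductSpace ℝ V]
    (T : Finset V) (a u : V) (hu : u ∈ Submodule.span ℝ (zs T a)) : ⟪a, u⟫_ℝ = 0 := by
  induction hu using Submodule.span_induction with
  | mem t ht => exact ht.2
  | zero => simp
  | add x y _ _ hx hy => rw [inner_add_right, hx, hy, add_zero]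
  | smul r x _ hx => rw [real_inner_smul_right, hx, mul_zero]

variable {n : ℕ} {P : Set (E n)} {S : Finset (E n)} {v : E n}

lemma N_iff (hS : P = convexHull ℝ (S : Set (E n))) (T : Finset (E n))
    (hT : ∀ t, t ∈ T ↔ ∃ s ∈ S, t = s - v) (a : E n) :
    (∀ t ∈ T, ⟪a, t⟫_ℝ ≤ 0) ↔ ∀ y ∈ P, ⟪a, y - v⟫_ℝ ≤ 0 := by
  constructor
  · intro h y hy
    have hsub : convexHull ℝ (S : Set (E n)) ⊆ {y | innerSL ℝ a y ≤ ⟪a, v⟫_ℝ} := by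
      apply convexHull_min
      · intro s hs
        have := h (s - v) ((hT _).2 ⟨s, hs, rfl⟩)
        rw [inner_sub_right] at this
        simp only [Set.mem_ofPred_eq, innerSL_apply_apply]
        linarith
      · exact convex_halfSpace_le (innerSL ℝ a).isLinear _
    have := hsub (hS ▸ hy)
    simp only [Set.mem_ofPred_eq, innerSL_apply_apply] at this
    rw [inner_sub_right]; linarith
  · intro h t ht
    obtain ⟨s, hs, rfl⟩ := (hT t).1 ht
    exact h s (hS ▸ subset_convexHull ℝ _ hs)

lemma dir_eq (hS : P = convexHull ℝ (S : Set (E n))) (T : Finset (E n))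
    (hT : ∀ t, t ∈ T ↔ ∃ s ∈ S, t = s - v) (hv : v ∈ P) (a : E n)
    (ha : ∀ t ∈ T, ⟪a, t⟫_ℝ ≤ 0) :
    vectorSpan ℝ (Fa P v a) = Submodule.span ℝ (zs T a) := by
  have hvF : v ∈ Fa P v a := ⟨hv, by simp⟩
  rw [vectorSpan_eq_span_vsub_set_right ℝ hvF]
  apply le_antisymm
  · rw [Submodule.span_le]
    rintro _ ⟨x, ⟨hxP, hx⟩, rfl⟩
    rw [hS, Finset.mem_convexHull'] at hxP
    obtain ⟨w, hw0, hw1, hwx⟩ := hxP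
    have hxv : x - v = ∑ y ∈ S, w y • (y - v) := by
      simp only [smul_sub, Finset.sum_sub_distrib, ← Finset.sum_smul, hw1, hwx, one_smul]
    have hin : ∀ y ∈ S, w y * ⟪a, y - v⟫_ℝ ≤ 0 := fun y hy =>
      mul_nonpos_of_nonneg_of_nonpos (hw0 y hy) (ha _ ((hT _).2 ⟨y, hy, rfl⟩))
    rw [hxv, inner_sum] at hx
    simp only [real_inner_smul_right] at hx
    rw [Finset.sum_eq_zero_iff_of_nonpos hin] at hx
    simp only [vsub_eq_sub, SetLike.mem_coe]
    rw [hxv]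
    apply Submodule.sum_mem
    intro y hy
    rcases mul_eq_zero.1 (hx y hy) with h | h
    · simp [h]
    · exact Submodule.smul_mem _ _ (Submodule.subset_span ⟨(hT _).2 ⟨y, hy, rfl⟩, h⟩)
  · apply Submodule.span_mono
    rintro t ⟨ht, hta⟩
    obtain ⟨s, hs, rfl⟩ := (hT t).1 ht
    exact ⟨s, ⟨hS ▸ subset_convexHull ℝ _ hs, hta⟩, rfl⟩

lemma Fa_eq (hS : P = convexHull ℝ (S : Set (E n))) (T : Finset (E n))
    (hT : ∀ t, t ∈ T ↔ ∃ s ∈ S, t = s - v) (hv : v ∈ P) (a : E n)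
    (ha : ∀ t ∈ T, ⟪a, t⟫_ℝ ≤ 0) :
    Fa P v a = {x | x ∈ P ∧ x - v ∈ Submodule.span ℝ (zs T a)} := by
  ext x
  constructor
  · intro hx
    refine ⟨hx.1, ?_⟩
    rw [← dir_eq hS T hT hv a ha]
    exact vsub_mem_vectorSpan ℝ hx ⟨hv, by simp⟩
  · rintro ⟨hx, h⟩
    exact ⟨hx, zs_orth T a _ h⟩

lemma Fa_exposed (a : E n) (ha : ∀ y ∈ P, ⟪a, y - v⟫_ℝ ≤ 0) (hv : v ∈ P) :
    IsExposed ℝ P (Fa P v a) := by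
  intro _
  refine ⟨innerSL ℝ a, ?_⟩
  ext x
  simp only [inner_sub_right] at ha
  simp only [Fa, Set.mem_ofPred_eq, innerSL_apply_apply, inner_sub_right]
  refine and_congr_right fun hx => ⟨fun h y hy => ?_, fun h => ?_⟩
  · linarith [ha y hy]
  · linarith [ha x hx, h v hv]

lemma face_repr {F : Set (E n)} (hF : IsExposed ℝ P F) (hvF : v ∈ F) :
    ∃ a : E n, (∀ y ∈ P, ⟪a, y - v⟫_ℝ ≤ 0) ∧ F = Fa P v a := by
  obtain ⟨l, hl⟩ := hF ⟨v, hvF⟩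
  have hva := hl ▸ hvF
  refine ⟨(InnerProductSpace.toDual ℝ (E n)).symm l, ?_, ?_⟩
  · intro y hy
    rw [InnerProductSpace.toDual_symm_apply, map_sub]
    linarith [hva.2 y hy]
  · rw [hl]
    ext x
    simp only [Fa, Set.mem_ofPred_eq, InnerProductSpace.toDual_symm_apply, map_sub]
    refine and_congr_right fun hx => ⟨fun h => ?_, fun h y hy => ?_⟩
    · linarith [hva.2 x hx, h v hva.1]
    · linarith [hva.2 y hy]

lemma vertex_structure (hn : 3 ≤ n) (hP : IsSimplePolytope n P) (hv : v ∈ P.extremePoints ℝ) :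
    ∃ Φ : Finset (Fin n) → Set (E n),
      (∀ I, I.Nonempty → IsIFace P (Φ I) (n - I.card) ∧ v ∈ Φ I) ∧
      (∀ I J, Φ I ⊆ Φ J ↔ J ⊆ I) ∧
      ∀ F, IsFace P F → v ∈ F → ∃ I, I.Nonempty ∧ F = Φ I := by
  classical
  obtain ⟨hpoly, hspan, hsimple⟩ := hP
  have hv0 : IsIFace P {v} 0 := (zero_face_iff hn hpoly hspan _).2 ⟨v, hv, rfl⟩
  have hcard := hsimple 0 (by omega) _ hv0
  have hvP : v ∈ P := hv.1
  obtain ⟨S, _, hS⟩ := hpoly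
  obtain ⟨T, hT⟩ : ∃ T : Finset (E n), ∀ t, t ∈ T ↔ ∃ s ∈ S, t = s - v :=
    ⟨S.image (fun s => s - v), fun t => by simp [eq_comm]⟩
  have hN := N_iff hS T hT
  have hdir := dir_eq hS T hT hvP
  have hFa := Fa_eq hS T hT hvP
  have hFa0 : Fa P v 0 = P := by ext x; simp [Fa]
  have hPtop : vectorSpan ℝ P = ⊤ := by
    rw [← direction_affineSpan, hspan, AffineSubspace.direction_top]
  have hfr : Module.finrank ℝ (E n) = n := by simp
  have hTtop : Submodule.span ℝ (T : Set (E n)) = ⊤ := by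
    have := hdir 0 (by simp)
    rw [hFa0, hPtop] at this
    rw [this]
    congr 1
    ext t; simp [zs]
  -- nonzero functionals give proper faces
  have hproper : ∀ a, Fa P v a = P → a = 0 := by
    intro a h
    apply mem_span_top_zero T hTtop
    intro t ht
    obtain ⟨s, hs, rfl⟩ := (hT t).1 ht
    have h1 : s ∈ P := hS ▸ subset_convexHull ℝ _ hs
    rw [← h] at h1
    exact h1.2
  set 𝓖 := {G : Set (E n) | IsIFace P G (n - 1) ∧ G ⊇ {v}} with h𝓖
  have hfin : 𝓖.Finite := Set.finite_of_ncard_ne_zero (by omega)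
  have : Finite 𝓖 := hfin
  obtain ⟨eqv⟩ : Nonempty (𝓖 ≃ Fin n) :=
    ⟨Finite.equivFinOfCardEq (by rw [Nat.card_coe_set_eq]; omega)⟩
  have hrep : ∀ i : Fin n, ∃ a : E n, (∀ y ∈ P, ⟪a, y - v⟫_ℝ ≤ 0) ∧
      (eqv.symm i : Set (E n)) = Fa P v a := fun i =>
    face_repr (eqv.symm i).2.1.1.2.2 ((eqv.symm i).2.2 rfl)
  choose l hl1 hl2 using hrep
  have hlN : ∀ i, ∀ t ∈ T, ⟪l i, t⟫_ℝ ≤ 0 := fun i => (hN _).2 (hl1 i)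
  have hl0 : ∀ i, l i ≠ 0 := by
    intro i h
    have h1 := hl2 i
    rw [h, hFa0] at h1
    exact (eqv.symm i).2.1.1.2.1 h1
  have hgen : ∀ a : E n, (∀ t ∈ T, ⟪a, t⟫_ℝ ≤ 0) →
      ∃ c : Fin n → ℝ, (∀ i, 0 ≤ c i) ∧ a = ∑ i, c i • l i := by
    apply cone_gen T hTtop
    · exact ⟨0, by simp, by simp⟩
    · rintro a b ⟨c, hc, rfl⟩ ⟨d, hd, rfl⟩
      exact ⟨c + d, fun i => add_nonneg (hc i) (hd i), by
        simp [add_smul, Finset.sum_add_distrib]⟩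
    · rintro r a hr ⟨c, hc, rfl⟩
      exact ⟨r • c, fun i => mul_nonneg hr (hc i), by simp [mul_smul, Finset.smul_sum]⟩
    · intro a ha ha0 hd
      have horth : a ∈ (Submodule.span ℝ (zs T a))ᗮ := by
        rw [Submodule.mem_orthogonal']; exact fun u hu => zs_orth T a u hu
      have hsum := Submodule.finrank_add_finrank_orthogonal (Submodule.span ℝ (zs T a))
      have hpos : 0 < Module.finrank ℝ (Submodule.span ℝ (zs T a))ᗮ := by
        rw [Module.finrank_pos_iff_exists_ne_zero]
        exact ⟨⟨a, horth⟩, by simpa using ha0⟩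
      have hG : Fa P v a ∈ 𝓖 := by
        refine ⟨⟨⟨⟨v, hvP, by simp⟩, fun h => ha0 (hproper a h),
          Fa_exposed a ((hN a).1 ha) hvP⟩, ?_⟩, ?_⟩
        · rw [faceDim_eq, hdir a ha]; omega
        · rintro _ rfl; exact ⟨hvP, by simp⟩
      obtain ⟨i, hi⟩ : ∃ i, Fa P v (l i) = Fa P v a :=
        ⟨eqv ⟨_, hG⟩, by rw [← hl2]; simp⟩
      have hU : Submodule.span ℝ (zs T (l i)) = Submodule.span ℝ (zs T a) := by
        rw [← hdir a ha, ← hdir _ (hlN i), hi]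
      have hlo : l i ∈ (Submodule.span ℝ (zs T a))ᗮ := by
        rw [Submodule.mem_orthogonal', ← hU]; exact fun u hu => zs_orth T _ u hu
      have h1 : Module.finrank ℝ (Submodule.span ℝ (zs T a))ᗮ = 1 := by omega
      obtain ⟨c, hc⟩ := (finrank_eq_one_iff_of_nonzero' (⟨l i, hlo⟩ : (Submodule.span ℝ (zs T a))ᗮ)
        (by simpa using hl0 i)).1 h1 ⟨a, horth⟩
      have hc' : c • l i = a := congrArg Subtype.val hc
      obtain ⟨t, ht, hlt⟩ : ∃ t ∈ T, ⟪l i, t⟫_ℝ ≠ 0 := by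
        by_contra! hcon
        exact hl0 i (mem_span_top_zero T hTtop _ hcon)
      have hlt' := lt_of_le_of_ne (hlN i t ht) hlt
      have hat := ha t ht
      rw [← hc', real_inner_smul_left] at hat
      refine ⟨Pi.single i c, fun j => ?_, ?_⟩
      · rcases eq_or_ne j i with rfl | hji
        · simp only [Pi.single_eq_same]
          by_contra hneg
          nlinarith
        · simp [hji]
      · rw [Finset.sum_eq_single i]
        · simp [hc']
        · intro j _ hji; simp [hji]
        · simp
  have hmemspan : ∀ a : E n, (∀ t ∈ T, ⟪a, t⟫_ℝ ≤ 0) → a ∈ Submodule.span ℝ (Set.range l) := by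
    intro a ha
    obtain ⟨c, _, rfl⟩ := hgen a ha
    exact Submodule.sum_mem _ fun i _ =>
      Submodule.smul_mem _ _ (Submodule.subset_span ⟨i, rfl⟩)
  have hli : LinearIndependent ℝ l := by
    apply linearIndependent_of_top_le_span_of_card_eq_finrank
    · intro m _
      obtain ⟨a, ha, hva⟩ := face_repr (v := v) hv0.1.2.2 rfl
      have haN := (hN a).2 ha
      obtain ⟨K, hK⟩ := bigK T a m haN (by
        intro t ht hta
        obtain ⟨s, hs, rfl⟩ := (hT t).1 ht
        have : s ∈ Fa P v a := ⟨hS ▸ subset_convexHull ℝ _ hs, hta⟩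
        rw [← hva] at this
        rw [Set.mem_singleton_iff.1 this]
        simp)
      have h1 := hmemspan _ (fun t ht => (hK t ht).1)
      have h2 := Submodule.smul_mem _ K (hmemspan a haN)
      simpa using Submodule.sub_mem _ h1 h2
    · simp
  have hsimp := simplicial T l hli hlN hgen
  have hcN : ∀ c : Fin n → ℝ, (∀ i, 0 ≤ c i) → ∀ t ∈ T, ⟪∑ i, c i • l i, t⟫_ℝ ≤ 0 := by
    intro c hc t ht
    rw [sum_inner]
    refine Finset.sum_nonpos fun i _ => ?_
    rw [real_inner_smul_left]
    exact mul_nonpos_of_nonneg_of_nonpos (hc i) (hlN i t ht)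
  let cc : Finset (Fin n) → Fin n → ℝ := fun I i => if i ∈ I then 1 else 0
  have hcc : ∀ I i, 0 ≤ cc I i := fun I i => by simp only [cc]; split_ifs <;> norm_num
  have hccs : ∀ I, {i | cc I i ≠ 0} = (I : Set (Fin n)) := fun I => by ext i; simp [cc]
  let A : Finset (Fin n) → E n := fun I => ∑ i, cc I i • l i
  have hAN : ∀ I, ∀ t ∈ T, ⟪A I, t⟫_ℝ ≤ 0 := fun I => hcN _ (hcc I)
  have hAo : ∀ I, (Submodule.span ℝ (zs T (A I)))ᗮ = Submodule.span ℝ (l '' (I : Set (Fin n))) :=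
    fun I => by rw [← hccs I]; exact hsimp _ (hcc I)
  have hdimI : ∀ I : Finset (Fin n), faceDim (Fa P v (A I)) + I.card = n := by
    intro I
    rw [faceDim_eq, hdir _ (hAN I)]
    have h1 := Submodule.finrank_add_finrank_orthogonal (Submodule.span ℝ (zs T (A I)))
    rw [hAo I, hfr] at h1
    have h2 : Module.finrank ℝ (Submodule.span ℝ (l '' (I : Set (Fin n)))) = I.card := by
      have h3 : LinearIndependent ℝ (fun i : I => l i) := hli.comp _ Subtype.val_injective
      have h4 := finrank_span_eq_card h3
      rw [Fintype.card_coe] at h4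
      rw [← h4, Set.image_eq_range]
      rfl
    omega
  refine ⟨fun I => Fa P v (A I), ?_, ?_, ?_⟩
  · intro I hI
    have hIc := hI.card_pos
    have hd := hdimI I
    change IsIFace P (Fa P v (A I)) (n - I.card) ∧ v ∈ Fa P v (A I)
    refine ⟨⟨⟨⟨v, hvP, by simp⟩, ?_, Fa_exposed _ ((hN _).1 (hAN I)) hvP⟩, by omega⟩, hvP, by simp⟩
    intro h
    rw [h, faceDim_eq, hPtop, finrank_top, hfr] at hd
    omega
  · intro I J
    have hmon : Fa P v (A I) ⊆ Fa P v (A J) ↔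
        Submodule.span ℝ (zs T (A I)) ≤ Submodule.span ℝ (zs T (A J)) := by
      constructor
      · intro h
        rw [← hdir _ (hAN I), ← hdir _ (hAN J)]
        exact vectorSpan_mono ℝ h
      · intro h
        rw [hFa _ (hAN I), hFa _ (hAN J)]
        exact fun x hx => ⟨hx.1, h hx.2⟩
    simp only
    rw [hmon, ← Submodule.orthogonal_le_orthogonal_iff, hAo, hAo]
    constructor
    · intro h j hj
      by_contra hjI
      exact hli.notMem_span_image (s := (I : Set (Fin n))) (by simpa using hjI)
        (h (Submodule.subset_span ⟨j, hj, rfl⟩))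
    · intro h
      exact Submodule.span_mono (Set.image_mono (by exact_mod_cast h))
  · intro F hF hvF
    obtain ⟨a, ha, rfl⟩ := face_repr hF.2.2 hvF
    have haN := (hN a).2 ha
    obtain ⟨c, hc, rfl⟩ := hgen a haN
    have hs : {i | c i ≠ 0} = ((Finset.univ.filter (fun i => c i ≠ 0) : Finset (Fin n)) :
      Set (Fin n)) := by ext i; simp
    refine ⟨Finset.univ.filter (fun i => c i ≠ 0), ?_, ?_⟩
    · by_contra hne
      rw [Finset.not_nonempty_iff_eq_empty, Finset.filter_eq_empty_iff] at hne
      apply hF.2.1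
      have : ∑ i, c i • l i = 0 := Finset.sum_eq_zero fun i hi => by
        have := hne hi
        simp only [not_not] at this
        simp [this]
      rw [this, hFa0]
    · beta_reduce
      rw [hFa _ haN, hFa _ (hAN _)]
      have h1 := hsimp c hc
      rw [hs, ← hAo] at h1
      have h2 := congrArg (fun W : Submodule ℝ (E n) => Submodule.orthogonal W) h1
      simp only [Submodule.orthogonal_orthogonal] at h2
      rw [h2]

end Vert

section Count

lemma ncard_at_vertex {n k : ℕ} {P : Set (E n)} {v : E n} (hk : k < n)
    (Φ : Finset (Fin n) → Set (E n))
    (h1 : ∀ I, I.Nonempty → IsIFace P (Φ I) (n - I.card) ∧ v ∈ Φ I)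
    (h2 : ∀ I J, Φ I ⊆ Φ J ↔ J ⊆ I)
    (h3 : ∀ F, IsFace P F → v ∈ F → ∃ I, I.Nonempty ∧ F = Φ I)
    (J : Finset (Fin n)) (hJ : v ∈ Φ J) :
    {F : Set (E n) | IsIFace P F k ∧ Φ J ⊆ F}.ncard = J.card.choose (n - k) := by
  have hinj : Function.Injective Φ := fun I K h =>
    Finset.Subset.antisymm ((h2 K I).1 h.ge) ((h2 I K).1 h.le)
  have hset : {F : Set (E n) | IsIFace P F k ∧ Φ J ⊆ F} =
      Φ '' (Finset.powersetCard (n - k) J : Finset (Finset (Fin n))) := by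
    ext F
    simp only [Set.mem_ofPred_eq, Set.mem_image, Finset.mem_coe, Finset.mem_powersetCard]
    constructor
    · rintro ⟨hF, hJF⟩
      obtain ⟨I, hI, rfl⟩ := h3 F hF.1 (hJF hJ)
      refine ⟨I, ⟨(h2 _ _).1 hJF, ?_⟩, rfl⟩
      have e1 := (h1 I hI).1.2
      have e2 := hF.2
      have e3 := Finset.card_le_univ I
      simp only [Fintype.card_fin] at e3
      omega
    · rintro ⟨I, ⟨hIJ, hc⟩, rfl⟩
      refine ⟨?_, (h2 _ _).2 hIJ⟩
      have := (h1 I (Finset.card_pos.1 (by omega))).1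
      rwa [hc, Nat.sub_sub_self hk.le] at this
  rw [hset, Set.ncard_image_of_injective _ hinj, Set.ncard_coe_finset, Finset.card_powersetCard]

lemma edges_at_vertex {n : ℕ} (hn : 3 ≤ n) {P : Set (E n)} (hP : IsSimplePolytope n P)
    (G : Set (E n)) (hG : IsIFace P G 0) :
    {F : Set (E n) | IsIFace P F 1 ∧ G ⊆ F}.ncard = n := by
  obtain ⟨v, hv, rfl⟩ := (zero_face_iff hn hP.1 hP.2.1 G).1 hG
  obtain ⟨Φ, h1, h2, h3⟩ := vertex_structure hn hP hv
  obtain ⟨I, hI, hvI⟩ := h3 _ hG.1 rfl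
  have := ncard_at_vertex (k := 1) (by omega) Φ h1 h2 h3 I (hvI ▸ rfl)
  rw [hvI, this]
  have e1 := (h1 I hI).1.2
  have e2 := hG.2
  have e3 := Finset.card_le_univ I
  simp only [Fintype.card_fin] at e3
  rw [hvI] at e2
  have : I.card = n := by omega
  rw [this, ← Nat.choose_symm (by omega), Nat.sub_sub_self (by omega), Nat.choose_one_right]

lemma two_faces_at_edge {n : ℕ} (hn : 3 ≤ n) {P : Set (E n)} (hP : IsSimplePolytope n P)
    (e : Set (E n)) (he : IsIFace P e 1) :
    {F : Set (E n) | IsIFace P F 2 ∧ e ⊆ F}.ncard = n - 1 := by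
  have hee := edge_ends hn hP.1 hP.2.1 e he
  obtain ⟨G, hG, hGe⟩ := Set.nonempty_of_ncard_ne_zero (by rw [hee]; norm_num)
  obtain ⟨v, hv, rfl⟩ := (zero_face_iff hn hP.1 hP.2.1 G).1 hG
  obtain ⟨Φ, h1, h2, h3⟩ := vertex_structure hn hP hv
  obtain ⟨I, hI, rfl⟩ := h3 _ he.1 (hGe rfl)
  rw [ncard_at_vertex (k := 2) (by omega) Φ h1 h2 h3 I (hGe rfl)]
  have e1 := (h1 I hI).1.2
  have e2 := he.2
  have e3 := Finset.card_le_univ I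
  simp only [Fintype.card_fin] at e3
  have : I.card = n - 1 := by omega
  rw [this, ← Nat.choose_symm (by omega), show n - 1 - (n - 2) = 1 by omega, Nat.choose_one_right]

end Count

/-- **Lemma 7.** For an `n`-dimensional simple polytope `P` (`n ≥ 3`) with `l` vertices,
`l/α₂ = (2/(n(n-1))) · α₂^{(1)}`. -/
theorem vertices_div_two_faces (n : ℕ) (hn : 3 ≤ n) (P : Set (E n))
    (hP : IsSimplePolytope n P) (l : ℕ) (hl : l = nFaces P 0) :
    (l : ℝ) / (nFaces P 2 : ℝ) = 2 / ((n : ℝ) * ((n : ℝ) - 1)) * avgFaces P 2 1 := by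
  classical
  have hfin : ∀ i, (facesOf P i).Finite := fun i =>
    (finite_faces hP.1).subset fun F hF => hF.1
  choose A hA using fun i => (hfin i).exists_finset_coe
  have hmem : ∀ i F, F ∈ A i ↔ IsIFace P F i := fun i F => by
    rw [← Finset.mem_coe, hA i]; rfl
  have hdown : ∀ i f, {G : Set (E n) | IsIFace P G i ∧ G ⊆ f}.ncard
      = ((A i).filter (fun G => G ⊆ f)).card := fun i f => by
    rw [← Set.ncard_coe_finset]; congr 1; ext G; simp [hmem]
  have hup : ∀ i f, {G : Set (E n) | IsIFace P G i ∧ f ⊆ G}.ncard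
      = ((A i).filter (fun G => f ⊆ G)).card := fun i f => by
    rw [← Set.ncard_coe_finset]; congr 1; ext G; simp [hmem]
  have hα : ∀ i, nFaces P i = (A i).card := fun i => by
    rw [nFaces, ← hA i, Set.ncard_coe_finset]
  have c1 : (A 0).card * n = (A 1).card * 2 := by
    apply Finset.card_mul_eq_card_mul (fun G e : Set (E n) => G ⊆ e)
    · intro G hG
      rw [Finset.bipartiteAbove, ← hup, edges_at_vertex hn hP G ((hmem _ _).1 hG)]
    · intro e he
      rw [Finset.bipartiteBelow, ← hdown, edge_ends hn hP.1 hP.2.1 e ((hmem _ _).1 he)]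
  have c2 : ∑ f ∈ A 2, nFacesIn P f 1 = (A 1).card * (n - 1) := by
    have := Finset.sum_card_bipartiteAbove_eq_sum_card_bipartiteBelow
      (s := A 1) (t := A 2) (fun e f : Set (E n) => e ⊆ f)
    have h1 : ∀ e ∈ A 1, ((A 2).bipartiteAbove (fun e f : Set (E n) => e ⊆ f) e).card = n - 1 := by
      intro e he
      rw [Finset.bipartiteAbove, ← hup, two_faces_at_edge hn hP e ((hmem _ _).1 he)]
    rw [Finset.sum_congr rfl h1, Finset.sum_const, smul_eq_mul] at this
    rw [this]
    refine Finset.sum_congr rfl fun f _ => ?_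
    rw [nFacesIn, hdown, Finset.bipartiteBelow]
  have c2' : (∑ᶠ f ∈ facesOf P 2, (nFacesIn P f 1 : ℝ)) = (A 1).card * ((n : ℝ) - 1) := by
    rw [← hA 2]
    simp only [Finset.mem_coe]
    rw [finsum_mem_finset_eq_sum]
    rw [← Nat.cast_sum, c2]
    push_cast [Nat.cast_sub (show 1 ≤ n by omega)]
    ring
  have c1' : ((A 0).card : ℝ) * n = (A 1).card * 2 := by exact_mod_cast c1
  have hn' : (3 : ℝ) ≤ n := by exact_mod_cast hn
  have hn1 : (n : ℝ) - 1 ≠ 0 := by linarith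
  have hn0 : (n : ℝ) ≠ 0 := by linarith
  rw [avgFaces, c2', hl, hα 0]
  have hA0 : ((A 0).card : ℝ) = (A 1).card * 2 / n := by field_simp; linarith
  rw [hA0]
  field_simp
end

section
/- (Equation (2), double counting of vertices of 2-faces.) Let n ≥ 3, let P be an n-dimensional simple polytope in ℝⁿ, and let l be the number of vertices of P. Then l·n·(n−1) = 2·Σ_{f a 2-face of P} (number of vertices of P contained in f); equivalently, l·n(n−1)/2 = Σ_{i≥3} i·mᵢ. -/
open scoped BigOperators

section DC

/-- outer normals of `P` at `v` -/
def NC {n : ℕ} (P : Set (E n)) (v : E n) : Set (E n) :=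
  {a | ∀ x ∈ P, inner ℝ a (x - v) ≤ 0}

/-- face of `P` through `v` with normal `a` -/
def Fc {n : ℕ} (P : Set (E n)) (v a : E n) : Set (E n) :=
  {x | x ∈ P ∧ inner ℝ a (x - v) = 0}

theorem nc_of_finset {n : ℕ} {P : Set (E n)} {S : Finset (E n)}
    (hPS : P = convexHull ℝ (S : Set (E n))) {v a : E n}
    (h : ∀ s ∈ S, inner ℝ a (s - v) ≤ 0) : a ∈ NC P v := by
  intro x hx
  have hc : Convex ℝ {x : E n | inner ℝ a x ≤ inner ℝ a v} :=
    convex_halfSpace_le (f := fun x : E n => inner ℝ a x)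
      ⟨fun x y => inner_add_right a x y, fun c x => by simp [inner_smul_right]⟩ _
  have : x ∈ {x : E n | inner ℝ a x ≤ inner ℝ a v} := by
    rw [hPS] at hx
    refine convexHull_min ?_ hc hx
    intro s hs
    have := h s hs
    rw [inner_sub_right] at this
    simp only [Set.mem_ofPred_eq]; linarith
  simp only [Set.mem_ofPred_eq] at this
  rw [inner_sub_right]; linarith

theorem fc_exposed {n : ℕ} {P : Set (E n)} {v a : E n} (hv : v ∈ P) (ha : a ∈ NC P v) :
    IsExposed ℝ P (Fc P v a) := by
  intro _
  refine ⟨innerSL ℝ a, ?_⟩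
  ext x
  simp only [Fc, Set.mem_ofPred_eq, innerSL_apply_apply]
  constructor
  · rintro ⟨hx, h0⟩
    refine ⟨hx, fun y hy => ?_⟩
    have := ha y hy
    rw [inner_sub_right] at this h0
    linarith
  · rintro ⟨hx, h0⟩
    refine ⟨hx, ?_⟩
    have h1 := ha x hx
    have h2 := h0 v hv
    rw [inner_sub_right] at h1 ⊢
    linarith

theorem exposed_fc {n : ℕ} {P F : Set (E n)} {v : E n} (hvF : v ∈ F)
    (h : IsExposed ℝ P F) : ∃ a ∈ NC P v, F = Fc P v a := by
  obtain ⟨l, hl⟩ := h ⟨v, hvF⟩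
  obtain ⟨a, rfl⟩ := (InnerProductSpace.toDual ℝ (E n)).surjective l
  rw [hl] at hvF
  obtain ⟨hv, hm⟩ := hvF
  simp only [InnerProductSpace.toDual_apply_apply] at hm hl
  have ha : a ∈ NC P v := by
    intro x hx
    have := hm x hx
    rw [inner_sub_right]; linarith
  refine ⟨a, ha, ?_⟩
  rw [hl]
  ext x
  simp only [Fc, Set.mem_ofPred_eq]
  constructor
  · rintro ⟨hx, h0⟩
    refine ⟨hx, ?_⟩
    have h1 := ha x hx
    have h2 := h0 v hv
    rw [inner_sub_right] at h1 ⊢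
    linarith
  · rintro ⟨hx, h0⟩
    refine ⟨hx, fun y hy => ?_⟩
    have := hm y hy
    rw [inner_sub_right] at h0
    linarith

theorem mem_fc_self {n : ℕ} {P : Set (E n)} {v : E n} (a : E n) (hv : v ∈ P) : v ∈ Fc P v a := by
  refine ⟨hv, by simp⟩

theorem orth_fc {n : ℕ} {P F : Set (E n)} {v b x : E n} (hvF : v ∈ F)
    (hb : b ∈ (vectorSpan ℝ F)ᗮ) (hx : x ∈ F) : inner ℝ b (x - v) = 0 := by
  rw [real_inner_comm]
  exact (Submodule.mem_orthogonal _ _).1 hb _ (vsub_mem_vectorSpan ℝ hx hvF)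

theorem fc_le_orth {n : ℕ} {P : Set (E n)} {v a : E n} :
    vectorSpan ℝ (Fc P v a) ≤ (Submodule.span ℝ {a})ᗮ := by
  rw [vectorSpan_def, Submodule.span_le]
  rintro _ ⟨x, hx, y, hy, rfl⟩
  simp only [SetLike.mem_coe, Submodule.mem_orthogonal_singleton_iff_inner_right]
  have h1 := hx.2
  have h2 := hy.2
  simp only [vsub_eq_sub]
  rw [inner_sub_right] at *
  linarith

theorem perturb_max {n : ℕ} {P : Set (E n)} {S : Finset (E n)}
    (hPS : P = convexHull ℝ (S : Set (E n))) {v a b : E n} (hv : v ∈ P) (ha : a ∈ NC P v)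
    (hb : b ∈ (vectorSpan ℝ (Fc P v a))ᗮ) (hpos : ∃ s ∈ S, 0 < inner ℝ b (s - v)) :
    ∃ t : ℝ, 0 < t ∧ a + t • b ∈ NC P v ∧
      ∃ s ∈ Fc P v (a + t • b), inner ℝ b (s - v) ≠ 0 := by
  classical
  have hSP : ∀ s ∈ S, s ∈ P := fun s hs => by rw [hPS]; exact subset_convexHull ℝ _ hs
  obtain ⟨s0, hs0, hs0p⟩ := hpos
  have hne : (S.filter (fun s => 0 < inner ℝ b (s - v))).Nonempty :=
    ⟨s0, by simp [hs0, hs0p]⟩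
  obtain ⟨s, hs, hmin⟩ := Finset.exists_min_image _
    (fun s : E n => - inner ℝ a (s - v) / inner ℝ b (s - v)) hne
  rw [Finset.mem_filter] at hs
  obtain ⟨hsS, hsp⟩ := hs
  have hneg : inner ℝ a (s - v) < 0 := by
    refine lt_of_le_of_ne (ha s (hSP s hsS)) fun h0 => ?_
    have := orth_fc (P := P) (mem_fc_self a hv) hb (x := s) ⟨hSP s hsS, h0⟩
    linarith
  set t := - inner ℝ a (s - v) / inner ℝ b (s - v) with ht
  have htp : 0 < t := div_pos (by linarith) hsp
  refine ⟨t, htp, nc_of_finset hPS ?_, s, ⟨hSP s hsS, ?_⟩, hsp.ne'⟩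
  · intro x hx
    rw [inner_add_left, real_inner_smul_left]
    by_cases hxp : 0 < inner ℝ b (x - v)
    · have := hmin x (by simp [hx, hxp])
      rw [le_div_iff₀ hxp] at this
      linarith
    · have h1 := ha x (hSP x hx)
      push Not at hxp
      nlinarith
  · rw [inner_add_left, real_inner_smul_left, ht, div_mul_cancel₀ _ hsp.ne']
    ring

theorem perturb {n : ℕ} {P : Set (E n)} {S : Finset (E n)}
    (hPS : P = convexHull ℝ (S : Set (E n))) {v a b : E n} (hv : v ∈ P) (ha : a ∈ NC P v)
    (hb : b ∈ (vectorSpan ℝ (Fc P v a))ᗮ) :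
    ∃ t : ℝ, 0 < t ∧ a + t • b ∈ NC P v := by
  by_cases hpos : ∃ s ∈ S, 0 < inner ℝ b (s - v)
  · obtain ⟨t, ht, h, _⟩ := perturb_max hPS hv ha hb hpos
    exact ⟨t, ht, h⟩
  · push Not at hpos
    refine ⟨1, one_pos, nc_of_finset hPS fun s hs => ?_⟩
    have h1 := hpos s hs
    have h2 := ha s (by rw [hPS]; exact subset_convexHull ℝ _ hs)
    rw [inner_add_left, real_inner_smul_left]
    linarith

theorem exists_inner_ne {n : ℕ} {P : Set (E n)} {S : Finset (E n)}
    (hPS : P = convexHull ℝ (S : Set (E n))) (hspan : vectorSpan ℝ P = ⊤) {v b : E n}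
    (hb : b ≠ 0) (hv : v ∈ P) : ∃ s ∈ S, inner ℝ b (s - v) ≠ 0 := by
  by_contra! hcon
  have h1 : b ∈ NC P v := nc_of_finset hPS fun s hs => (hcon s hs).le
  have h2 : -b ∈ NC P v := nc_of_finset hPS fun s hs => by
    rw [inner_neg_left, hcon s hs]; simp
  have hF : Fc P v b = P := by
    ext x
    refine ⟨fun h => h.1, fun hx => ⟨hx, ?_⟩⟩
    have h3 := h1 x hx
    have h4 := h2 x hx
    rw [inner_neg_left] at h4
    linarith
  have := fc_le_orth (P := P) (v := v) (a := b)
  rw [hF, hspan] at this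
  have hb0 : b ∈ (Submodule.span ℝ {b})ᗮ := this trivial
  rw [Submodule.mem_orthogonal_singleton_iff_inner_right] at hb0
  exact hb (inner_self_eq_zero.1 hb0)

/-- the normal cone is generated by the facet normals -/
theorem cone_gen_s4 {n : ℕ} (hn : 3 ≤ n) {P : Set (E n)} {S : Finset (E n)}
    (hPS : P = convexHull ℝ (S : Set (E n))) (hspan : vectorSpan ℝ P = ⊤) {v : E n} (hv : v ∈ P)
    {ι : Type*} [Fintype ι] (g : ι → E n) (hg : ∀ i, g i ∈ NC P v)
    (hg0 : ∀ i, g i ≠ 0)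
    (hfac : ∀ F, IsIFace P F (n - 1) → v ∈ F → ∃ i, F = Fc P v (g i)) :
    ∀ (k : ℕ) (a : E n), a ∈ NC P v → n ≤ Module.finrank ℝ (vectorSpan ℝ (Fc P v a)) + k →
      ∃ c : ι → ℝ, (∀ i, 0 ≤ c i) ∧ a = ∑ i, c i • g i := by
  classical
  intro k
  induction k using Nat.strong_induction_on with
  | _ k ih =>
  intro a ha hk
  by_cases ha0 : a = 0
  · exact ⟨fun _ => 0, fun _ => le_rfl, by simp [ha0]⟩
  have hEn : Module.finrank ℝ (E n) = n := by simp
  set W := vectorSpan ℝ (Fc P v a) with hW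
  have hWn := W.finrank_add_finrank_orthogonal
  rw [hEn] at hWn
  have haW : a ∈ Wᗮ := by
    have := fc_le_orth (P := P) (v := v) (a := a)
    have h2 := Submodule.orthogonal_le this
    exact h2 (Submodule.le_orthogonal_orthogonal _ (Submodule.mem_span_singleton_self a))
  have hpos1 : 0 < Module.finrank ℝ Wᗮ := by
    rw [Module.finrank_pos_iff_exists_ne_zero]
    exact ⟨⟨a, haW⟩, by simpa [Subtype.ext_iff] using ha0⟩
  by_cases hone : Module.finrank ℝ Wᗮ = 1
  · have hface : IsIFace P (Fc P v a) (n - 1) := by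
      have hd : faceDim (Fc P v a) = n - 1 := by
        rw [faceDim, direction_affineSpan, ← hW]; omega
      refine ⟨⟨⟨v, mem_fc_self a hv⟩, ?_, fc_exposed hv ha⟩, hd⟩
      intro h
      rw [h, faceDim, direction_affineSpan, hspan, finrank_top, hEn] at hd
      omega
    obtain ⟨i, hi⟩ := hfac _ hface (mem_fc_self a hv)
    have hgW : g i ∈ Wᗮ := by
      have := fc_le_orth (P := P) (v := v) (a := g i)
      have h2 := Submodule.orthogonal_le this
      rw [← hi] at h2
      exact h2 (Submodule.le_orthogonal_orthogonal _ (Submodule.mem_span_singleton_self _))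
    obtain ⟨c, hc⟩ := (finrank_eq_one_iff_of_nonzero' (⟨g i, hgW⟩ : Wᗮ)
      (by simpa [Subtype.ext_iff] using hg0 i)).1 hone ⟨a, haW⟩
    have hc' : c • g i = a := by simpa [Subtype.ext_iff] using hc
    obtain ⟨s, hs, hsne⟩ := exists_inner_ne hPS hspan (hg0 i) hv
    have hsP : s ∈ P := by rw [hPS]; exact subset_convexHull ℝ _ hs
    have h1 : inner ℝ (g i) (s - v) < 0 := lt_of_le_of_ne (hg i s hsP) hsne
    have h2 := ha s hsP
    rw [← hc', real_inner_smul_left] at h2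
    have hc0 : 0 ≤ c := by
      by_contra! h
      nlinarith [mul_pos_of_neg_of_neg h h1]
    refine ⟨Pi.single i c, ?_, ?_⟩
    · intro j
      by_cases hj : j = i
      · subst hj; simpa using hc0
      · simp [Pi.single_eq_of_ne hj]
    · rw [Finset.sum_eq_single i]
      · simp [hc']
      · intro j _ hj; simp [Pi.single_eq_of_ne hj]
      · simp
  · set x0 := ∑ s ∈ S, (s - v) with hx0
    have : ∃ b ∈ (W ⊔ Submodule.span ℝ {x0})ᗮ, b ≠ 0 := by
      apply Submodule.exists_mem_ne_zero_of_ne_bot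
      intro hbot
      have h1 := (W ⊔ Submodule.span ℝ {x0}).finrank_add_finrank_orthogonal
      rw [hbot, finrank_bot, hEn] at h1
      have h2 := Submodule.finrank_add_le_finrank_add_finrank W (Submodule.span ℝ {x0})
      have h3 := finrank_span_le_card (R := ℝ) ({x0} : Set (E n))
      simp at h3
      omega
    obtain ⟨b, hb, hb0⟩ := this
    have hbW : b ∈ Wᗮ := Submodule.orthogonal_le le_sup_left hb
    have hbx : inner ℝ b x0 = 0 := by
      have := Submodule.orthogonal_le (le_sup_right : Submodule.span ℝ {x0} ≤ W ⊔ _) hb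
      rwa [Submodule.mem_orthogonal_singleton_iff_inner_left] at this
    rw [hx0, inner_sum] at hbx
    obtain ⟨sp, hsp, hspp⟩ := Finset.exists_pos_of_sum_zero_of_exists_nonzero _ hbx
      (exists_inner_ne hPS hspan hb0 hv)
    obtain ⟨sm, hsm, hsmp⟩ := Finset.exists_pos_of_sum_zero_of_exists_nonzero
      (s := S) (fun s => inner ℝ (-b) (s - v)) (by simp [inner_neg_left, hbx])
      (exists_inner_ne hPS hspan (neg_ne_zero.2 hb0) hv)
    have key : ∀ b' ∈ Wᗮ, (∃ s ∈ S, 0 < inner ℝ b' (s - v)) → ∃ t : ℝ, 0 < t ∧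
        ∃ c : ι → ℝ, (∀ i, 0 ≤ c i) ∧ a + t • b' = ∑ i, c i • g i := by
      intro b' hb' hex
      obtain ⟨t, ht, hN, s, hs, hsne⟩ := perturb_max hPS hv ha hb' hex
      refine ⟨t, ht, ?_⟩
      have hlt : W < vectorSpan ℝ (Fc P v (a + t • b')) := by
        refine lt_of_le_of_ne (vectorSpan_mono ℝ ?_) ?_
        · intro x hx
          refine ⟨hx.1, ?_⟩
          rw [inner_add_left, real_inner_smul_left, hx.2,
            orth_fc (P := P) (mem_fc_self a hv) hb' hx]
          simp
        · intro heq
          rw [heq] at hb'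
          exact hsne (orth_fc (P := P) (mem_fc_self _ hv) hb' hs)
      have hlt' := Submodule.finrank_lt_finrank_of_lt hlt
      exact ih (k - 1) (by omega) _ hN (by omega)
    obtain ⟨t, ht, c, hc, hce⟩ := key b hbW ⟨sp, hsp, hspp⟩
    obtain ⟨t', ht', c', hc', hce'⟩ := key (-b) (Submodule.neg_mem _ hbW) ⟨sm, hsm, hsmp⟩
    refine ⟨fun i => (t' / (t + t')) * c i + (t / (t + t')) * c' i, fun i => ?_, ?_⟩
    · have := hc i
      have := hc' i
      positivity
    · simp only [add_smul, mul_smul, Finset.sum_add_distrib, ← Finset.smul_sum]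
      rw [← hce, ← hce']
      have hne : t + t' ≠ 0 := by positivity
      have e1 : t' / (t + t') + t / (t + t') = 1 := by field_simp; ring
      have e2 : t' / (t + t') * t = t / (t + t') * t' := by ring
      have : a = (t' / (t + t') + t / (t + t')) • a + (t' / (t + t') * t - t / (t + t') * t') • b := by
        rw [e1, e2]; simp
      conv_lhs => rw [this]
      module


theorem finite_exposed {n : ℕ} {P : Set (E n)} {S : Finset (E n)}
    (hPS : P = convexHull ℝ (S : Set (E n))) : {F | IsExposed ℝ P F}.Finite := by
  have hcpt : IsCompact P := by rw [hPS]; exact S.finite_toSet.isCompact_convexHull (𝕜 := ℝ)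
  have hcvx : Convex ℝ P := by rw [hPS]; exact convex_convexHull ℝ _
  have hext : P.extremePoints ℝ ⊆ S := by rw [hPS]; exact extremePoints_convexHull_subset
  have hfin : (P.extremePoints ℝ).Finite := S.finite_toSet.subset hext
  refine Set.Finite.of_finite_image (f := fun F => F ∩ P.extremePoints ℝ) ?_ ?_
  · refine hfin.finite_subsets.subset ?_
    rintro _ ⟨F, _, rfl⟩
    exact Set.inter_subset_right
  · intro F hF G hG h
    change F ∩ _ = G ∩ _ at h
    rw [← closure_convexHull_extremePoints (hF.isCompact hcpt) (hF.convex hcvx),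
      ← closure_convexHull_extremePoints (hG.isCompact hcpt) (hG.convex hcvx),
      hF.isExtreme.extremePoints_eq, hG.isExtreme.extremePoints_eq, h]

theorem fc_sum {n : ℕ} {P : Set (E n)} {v : E n} {ι : Type*} [Fintype ι] [DecidableEq ι]
    (g : ι → E n) (hg : ∀ i, g i ∈ NC P v) (c : ι → ℝ) (hc : ∀ i, 0 ≤ c i) :
    Fc P v (∑ i, c i • g i) = {x | x ∈ P ∧ ∀ i, c i ≠ 0 → inner ℝ (g i) (x - v) = 0} := by
  ext x
  simp only [Fc, Set.mem_ofPred_eq]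
  refine and_congr_right fun hx => ?_
  rw [sum_inner, Finset.sum_eq_zero_iff_of_nonpos]
  · simp only [Finset.mem_univ, true_imp_iff, real_inner_smul_left, mul_eq_zero]
    exact forall_congr' fun i => by tauto
  · intro i _
    rw [real_inner_smul_left]
    exact mul_nonpos_of_nonneg_of_nonpos (hc i) (hg i x hx)

/-- intersection of a family of facets -/
def FI {n : ℕ} (P : Set (E n)) (v : E n) {ι : Type*} (g : ι → E n) (I : Finset ι) : Set (E n) :=
  {x | x ∈ P ∧ ∀ i ∈ I, inner ℝ (g i) (x - v) = 0}

theorem fi_eq {n : ℕ} {P : Set (E n)} {v : E n} {ι : Type*} [Fintype ι] [DecidableEq ι]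
    (g : ι → E n) (hg : ∀ i, g i ∈ NC P v) (I : Finset ι) :
    FI P v g I = Fc P v (∑ i, (if i ∈ I then (1 : ℝ) else 0) • g i) := by
  rw [fc_sum g hg _ (fun i => by split_ifs <;> norm_num)]
  ext x
  simp [FI]

theorem sum_mem_nc {n : ℕ} {P : Set (E n)} {v : E n} {ι : Type*} [Fintype ι]
    (g : ι → E n) (hg : ∀ i, g i ∈ NC P v) (c : ι → ℝ) (hc : ∀ i, 0 ≤ c i) :
    ∑ i, c i • g i ∈ NC P v := by
  intro x hx
  rw [sum_inner]
  refine Finset.sum_nonpos fun i _ => ?_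
  rw [real_inner_smul_left]
  exact mul_nonpos_of_nonneg_of_nonpos (hc i) (hg i x hx)

theorem fi_dim {n : ℕ} {P : Set (E n)} {S : Finset (E n)}
    (hPS : P = convexHull ℝ (S : Set (E n))) {v : E n} (hv : v ∈ P)
    {ι : Type*} [Fintype ι] [DecidableEq ι] (g : ι → E n) (hg : ∀ i, g i ∈ NC P v)
    (hli : LinearIndependent ℝ g) (hsp : ⊤ ≤ Submodule.span ℝ (Set.range g))
    (hgen : ∀ a ∈ NC P v, ∃ c : ι → ℝ, (∀ i, 0 ≤ c i) ∧ a = ∑ i, c i • g i)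
    (I : Finset ι) : faceDim (FI P v g I) + I.card = n := by
  set G := Submodule.span ℝ (g '' (I : Set ι)) with hG
  have hGr : Module.finrank ℝ G = I.card := by
    have := finrank_span_eq_card (hli.comp (Subtype.val : I → ι) Subtype.val_injective)
    rw [Set.range_comp, Subtype.range_coe_subtype] at this
    rw [Fintype.card_coe] at this
    exact this
  have hEn : Module.finrank ℝ (E n) = n := by simp
  have hGn := G.finrank_add_finrank_orthogonal
  rw [hEn, hGr] at hGn
  set W := vectorSpan ℝ (FI P v g I) with hW
  have h1 : G ≤ Wᗮ := by
    rw [hG, Submodule.span_le]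
    rintro _ ⟨i, hi, rfl⟩
    have hsub : FI P v g I ⊆ Fc P v (g i) := fun x hx => ⟨hx.1, hx.2 i hi⟩
    have h2 := Submodule.orthogonal_le ((vectorSpan_mono ℝ hsub).trans fc_le_orth)
    exact h2 (Submodule.le_orthogonal_orthogonal _ (Submodule.mem_span_singleton_self _))
  have h2 : Wᗮ ≤ G := by
    intro b hb
    let B := Module.Basis.mk hli hsp
    have hBg : ∀ i, B i = g i := fun i => by simp [B]
    have hneg : ∀ b ∈ Wᗮ, ∀ i ∉ I, 0 ≤ B.repr b i := by
      intro b hb i hi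
      rw [hW, fi_eq g hg] at hb
      obtain ⟨t, ht, hN⟩ := perturb hPS hv (sum_mem_nc g hg _
        (fun i => by split_ifs <;> norm_num)) hb
      obtain ⟨c, hc, hce⟩ := hgen _ hN
      have := congrArg (fun x => B.repr x i) hce
      simp only [← hBg, map_add, map_sum, map_smul, Finsupp.add_apply, Finsupp.smul_apply,
        Finsupp.finset_sum_apply, Module.Basis.repr_self, Finsupp.single_apply, smul_eq_mul] at this
      simp [hi] at this
      have h3 := hc i
      rw [← this] at h3
      exact nonneg_of_mul_nonneg_right h3 ht
    rw [← B.sum_repr b]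
    refine Submodule.sum_mem _ fun i _ => ?_
    by_cases hi : i ∈ I
    · rw [hBg]
      exact Submodule.smul_mem _ _ (Submodule.subset_span ⟨i, hi, rfl⟩)
    · have e1 := hneg b hb i hi
      have e2 := hneg (-b) (Submodule.neg_mem _ hb) i hi
      simp at e2
      rw [le_antisymm e2 e1]
      simp
  have h3 : G = Wᗮ := le_antisymm h1 h2
  have hWn := W.finrank_add_finrank_orthogonal
  rw [hEn, ← h3, hGr] at hWn
  rw [faceDim, direction_affineSpan, ← hW]
  exact hWn

theorem count_at_vertex {n : ℕ} (hn : 3 ≤ n) {P : Set (E n)} (hP : IsSimplePolytope n P)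
    {V : Set (E n)} (hV : IsIFace P V 0) :
    {F | IsIFace P F 2 ∧ V ⊆ F}.ncard = n.choose 2 := by
  classical
  obtain ⟨⟨S, -, hPS⟩, hspan, hsimple⟩ := hP
  have hEn : Module.finrank ℝ (E n) = n := by simp
  have hspan' : vectorSpan ℝ P = ⊤ := by
    rw [← direction_affineSpan, hspan, AffineSubspace.direction_top]
  have hfacets := hsimple 0 (Nat.zero_le _) V hV
  obtain ⟨⟨⟨v, hvV⟩, -, hVe⟩, hVd⟩ := hV
  have hVv : V = {v} := by
    rw [faceDim, direction_affineSpan, Submodule.finrank_eq_zero, vectorSpan_eq_bot_iff_subsingleton] at hVd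
    exact hVd.eq_singleton_of_mem hvV
  subst hVv
  have hv : v ∈ P := hVe.subset hvV
  simp only [Set.singleton_subset_iff, Nat.sub_zero, ge_iff_le, Set.le_eq_subset] at hfacets ⊢
  set ι := {G : Set (E n) | IsIFace P G (n - 1) ∧ v ∈ G} with hι
  have hιf : ι.Finite := Set.finite_of_ncard_pos (by omega)
  haveI : Fintype ι := hιf.fintype
  have hcard : Fintype.card ι = n := by
    rw [← Nat.card_eq_fintype_card]; exact hfacets
  have hch : ∀ i : ι, ∃ a ∈ NC P v, (i : Set (E n)) = Fc P v a := fun i =>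
    exposed_fc i.2.2 i.2.1.1.2.2
  choose g hg hgi using hch
  have hg0 : ∀ i, g i ≠ 0 := by
    intro i h
    have := hgi i
    rw [h] at this
    apply i.2.1.1.2.1
    rw [this]; ext x; simp [Fc]
  have hgen : ∀ a ∈ NC P v, ∃ c : ι → ℝ, (∀ i, 0 ≤ c i) ∧ a = ∑ i, c i • g i := fun a ha =>
    cone_gen_s4 hn hPS hspan' hv g hg hg0 (fun F hF hvF => ⟨⟨F, hF, hvF⟩, hgi ⟨F, hF, hvF⟩⟩) n a ha
      (by omega)
  obtain ⟨a0, ha0, hVa⟩ := exposed_fc hvV hVe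
  have hsp : ⊤ ≤ Submodule.span ℝ (Set.range g) := by
    have hmem : ∀ a ∈ NC P v, a ∈ Submodule.span ℝ (Set.range g) := by
      intro a ha
      obtain ⟨c, -, rfl⟩ := hgen a ha
      exact Submodule.sum_mem _ fun i _ => Submodule.smul_mem _ _ (Submodule.subset_span ⟨i, rfl⟩)
    intro b _
    obtain ⟨t, ht, hN⟩ := perturb (b := b) hPS hv ha0 (by rw [← hVa]; simp)
    have := Submodule.sub_mem _ (hmem _ hN) (hmem _ ha0)
    rw [add_sub_cancel_left] at this
    exact (Submodule.smul_mem_iff _ ht.ne').1 this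
  have hli : LinearIndependent ℝ g :=
    linearIndependent_of_top_le_span_of_card_eq_finrank hsp (by rw [hcard, hEn])
  have hdim := fi_dim hPS hv g hg hli hsp hgen
  have himg : {F | IsIFace P F 2 ∧ v ∈ F} =
      FI P v g '' ((Finset.univ : Finset ι).powersetCard (n - 2) : Set (Finset ι)) := by
    ext F
    simp only [Set.mem_ofPred_eq, Set.mem_image, Finset.mem_coe, Finset.mem_powersetCard,
      Finset.subset_univ, true_and]
    constructor
    · rintro ⟨⟨⟨-, -, hFe⟩, hFd⟩, hvF⟩
      obtain ⟨a, ha, hFa⟩ := exposed_fc hvF hFe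
      obtain ⟨c, hc, rfl⟩ := hgen a ha
      rw [fc_sum g hg c hc] at hFa
      have hFI : FI P v g (Finset.univ.filter (fun i => c i ≠ 0)) = F := by
        rw [hFa]; ext x; simp [FI]
      refine ⟨_, ?_, hFI⟩
      have := hdim (Finset.univ.filter (fun i => c i ≠ 0))
      rw [hFI, hFd] at this
      omega
    · rintro ⟨I, hI, rfl⟩
      have hd := hdim I
      have hd2 : faceDim (FI P v g I) = 2 := by omega
      have hvm : v ∈ FI P v g I := ⟨hv, by simp⟩
      refine ⟨⟨⟨⟨v, hvm⟩, ?_, ?_⟩, hd2⟩, hvm⟩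
      · intro h
        rw [h, faceDim, direction_affineSpan, hspan', finrank_top, hEn] at hd2
        omega
      · rw [fi_eq g hg]
        exact fc_exposed hv (sum_mem_nc g hg _ (fun i => by split_ifs <;> norm_num))
  have hinj : Function.Injective (FI P v g) := by
    have : ∀ I J, FI P v g I = FI P v g J → I ⊆ J := by
      intro I J h
      have hu : FI P v g (I ∪ J) = FI P v g J := by
        ext x
        constructor
        · exact fun hx => ⟨hx.1, fun i hi => hx.2 i (Finset.mem_union_right _ hi)⟩
        · intro hx
          have hx' := hx
          rw [← h] at hx'
          refine ⟨hx.1, fun i hi => ?_⟩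
          rcases Finset.mem_union.1 hi with hi | hi
          · exact hx'.2 i hi
          · exact hx.2 i hi
      have h1 := hdim (I ∪ J)
      have h2 := hdim J
      rw [hu] at h1
      have h3 := Finset.eq_of_subset_of_card_le (Finset.subset_union_right : J ⊆ I ∪ J) (by omega)
      rw [h3]
      exact Finset.subset_union_left
    exact fun I J h => (this I J h).antisymm (this J I h.symm)
  rw [himg, Set.ncard_image_of_injective _ hinj, Set.ncard_coe_finset, Finset.card_powersetCard,
    Finset.card_univ, hcard]
  exact Nat.choose_symm (by omega)

end DC


/-- **Equation (2).** Double counting of vertices of 2-faces: for an `n`-dimensional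
simple polytope `P` (`n ≥ 3`) with `l` vertices,
`l·n·(n-1) = 2·Σ_{f a 2-face} (number of vertices of P contained in f)`. -/
theorem double_count_vertices_of_two_faces (n : ℕ) (hn : 3 ≤ n) (P : Set (E n))
    (hP : IsSimplePolytope n P) (l : ℕ) (hl : l = nFaces P 0) :
    l * n * (n - 1) = 2 * ∑ᶠ f ∈ facesOf P 2, nFacesIn P f 0 := by
  classical
  subst hl
  obtain ⟨S, -, hPS⟩ := hP.1
  have hfin : ∀ i, (facesOf P i).Finite := fun i =>
    (finite_exposed hPS).subset fun F hF => hF.1.2.2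
  rw [finsum_mem_eq_finite_toFinset_sum _ (hfin 2)]
  have e1 : ∀ f, nFacesIn P f 0 =
      (Finset.bipartiteBelow (fun G F : Set (E n) => G ⊆ F) (hfin 0).toFinset f).card := by
    intro f
    rw [← Set.ncard_coe_finset, nFacesIn]
    congr 1
    ext G
    simp [Finset.bipartiteBelow, facesOf]
  have e2 : ∀ G ∈ (hfin 0).toFinset,
      (Finset.bipartiteAbove (fun G F : Set (E n) => G ⊆ F) (hfin 2).toFinset G).card
        = n.choose 2 := by
    intro G hG
    rw [← count_at_vertex hn hP (V := G) (by simpa [facesOf] using hG), ← Set.ncard_coe_finset]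
    congr 1
    ext F
    simp [Finset.bipartiteAbove, facesOf]
  rw [Finset.sum_congr rfl fun f _ => e1 f,
    ← Finset.sum_card_bipartiteAbove_eq_sum_card_bipartiteBelow, Finset.sum_congr rfl e2,
    Finset.sum_const, smul_eq_mul, nFaces, Set.ncard_eq_toFinset_card _ (hfin 0),
    mul_left_comm, Nat.choose_two_right, Nat.mul_div_cancel' (Nat.even_mul_pred_self n).two_dvd,
    mul_assoc]
end

section
/- (Intermediate inequality (7).) Let n ≥ 3 and let P be an n-dimensional simple polytope in ℝⁿ such that every vertex of P is contained in at most n+6 quadrilateral 2-faces and such that α₂^{(1)} < 4(n−1+ε)/(n−2+ε). Then m₄/α₂ < 2(n+6)(n−1+ε)/(n(n−1)(n−2+ε)) as real numbers. -/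
open scoped BigOperators

theorem aux_face_eq {n : ℕ} {S : Finset (E n)} {F : Set (E n)}
    (hF : IsExposed ℝ (convexHull ℝ (S : Set (E n))) F) :
    F = convexHull ℝ ((S : Set (E n)) ∩ F) := by
  have hc := S.finite_toSet.isCompact_convexHull ℝ
  have hFc := hF.isCompact hc
  have hFconv := hF.convex (convex_convexHull ℝ _)
  apply Set.Subset.antisymm
  · have h := closure_convexHull_extremePoints hFc hFconv
    have hfin : ((S : Set (E n)) ∩ F).Finite := S.finite_toSet.inter_of_left F
    conv_lhs => rw [← h]
    apply closure_minimal _ (hfin.isClosed_convexHull ℝ)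
    apply convexHull_mono
    intro x hx
    exact ⟨extremePoints_convexHull_subset (hF.isExtreme.extremePoints_subset_extremePoints hx), hx.1⟩
  · exact convexHull_min Set.inter_subset_right hFconv

theorem aux_finite {n : ℕ} {P : Set (E n)} (hP : IsPolytope P) :
    {F : Set (E n) | IsFace P F}.Finite := by
  obtain ⟨S, -, rfl⟩ := hP
  apply Set.Finite.subset ((S.finite_toSet.powerset).image (fun T => convexHull ℝ T))
  rintro F ⟨-, -, hF⟩
  exact ⟨(S : Set (E n)) ∩ F, Set.inter_subset_left, (aux_face_eq hF).symm⟩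

/-- exposed points of a finite set span -/
theorem aux_span {n : ℕ} (T : Finset (E n)) :
    ∃ X : Finset (E n), X ⊆ T ∧ Submodule.span ℝ (T : Set (E n)) = Submodule.span ℝ (X : Set (E n)) ∧
      ∀ w ∈ X, ∃ g : E n →L[ℝ] ℝ, ∀ t ∈ T, t ≠ w → g t < g w := by
  classical
  set Q := convexHull ℝ (T : Set (E n)) with hQ
  have hsub : Q.extremePoints ℝ ⊆ T := extremePoints_convexHull_subset
  refine ⟨T.filter (· ∈ Q.extremePoints ℝ), Finset.filter_subset _ _, ?_, ?_⟩
  · apply le_antisymm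
    · rw [Submodule.span_le]
      have h := closure_convexHull_extremePoints (T.finite_toSet.isCompact_convexHull ℝ)
        (convex_convexHull ℝ _)
      intro t ht
      have h1 : t ∈ Q := subset_convexHull ℝ _ ht
      rw [hQ, ← h] at h1
      refine closure_minimal (convexHull_min ?_ (Submodule.convex _))
        (Submodule.closed_of_finiteDimensional _) h1
      intro x hx
      apply Submodule.subset_span
      simpa using ⟨hsub hx, hx⟩
    · apply Submodule.span_mono
      intro x hx
      simp at hx
      exact hx.1
  · intro w hw
    simp only [Finset.mem_filter] at hw
    have h2 := ((convex_convexHull ℝ _).mem_extremePoints_iff_mem_sdiff_convexHull_sdiff).1 hw.2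
    have h3 : w ∉ convexHull ℝ ((T : Set (E n)) \ {w}) := fun h =>
      h2.2 (convexHull_mono (Set.diff_subset_diff_left (subset_convexHull ℝ _)) h)
    obtain ⟨g, u, hg, hu⟩ := geometric_hahn_banach_closed_point (convex_convexHull ℝ _)
      ((T.finite_toSet.diff).isClosed_convexHull ℝ) h3
    exact ⟨g, fun t ht htw => (hg t (subset_convexHull ℝ _ ⟨ht, htw⟩)).trans hu⟩

theorem aux_up {n k : ℕ} {P : Set (E n)} (hP : IsPolytope P) (hspan : affineSpan ℝ P = ⊤)
    (hk : k + 1 < n) {F : Set (E n)} (hF : IsIFace P F k) :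
    n - k ≤ {G : Set (E n) | IsIFace P G (k + 1) ∧ F ⊆ G}.ncard := by
  classical
  have hfin : {G : Set (E n) | IsIFace P G (k + 1) ∧ F ⊆ G}.Finite :=
    (aux_finite hP).subset (fun G hG => hG.1.1)
  obtain ⟨S, hS, rfl⟩ := hP
  obtain ⟨⟨⟨f, hf⟩, -, hFe⟩, hdim⟩ := hF
  obtain ⟨l, hl⟩ := hFe ⟨f, hf⟩
  set P := convexHull ℝ (S : Set (E n)) with hPdef
  set L := vectorSpan ℝ F with hL
  have hdimL : Module.finrank ℝ L = k := by
    rw [hL, ← direction_affineSpan]; exact hdim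
  have hfP : f ∈ P := hFe.subset hf
  have hmemF : ∀ x ∈ P, (x ∈ F ↔ l x = l f) := by
    intro x hx
    have hf' := hf
    rw [hl] at hf'
    constructor
    · intro h
      rw [hl] at h
      exact le_antisymm (hf'.2 x hx) (h.2 f hfP)
    · intro h
      rw [hl]
      exact ⟨hx, fun y hy => by rw [h]; exact hf'.2 y hy⟩
  have hlle : ∀ x ∈ P, l x ≤ l f := by
    have hf' := hf
    rw [hl] at hf'
    exact hf'.2
  have hSP : ∀ s ∈ S, s ∈ P := fun s hs => subset_convexHull ℝ _ hs
  -- l vanishes on L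
  have hlL : ∀ x ∈ L, l x = 0 := by
    have : L ≤ LinearMap.ker l.toLinearMap := by
      rw [hL, vectorSpan_eq_span_vsub_set_right ℝ hf, Submodule.span_le]
      rintro _ ⟨x, hx, rfl⟩
      have := (hmemF x (hFe.subset hx)).1 hx
      simp [this]
    intro x hx
    exact this hx
  set π : E n →L[ℝ] E n := Lᗮ.starProjection with hπ
  have hker : ∀ x, π x = 0 ↔ x ∈ L := by
    intro x
    have := Lᗮ.ker_starProjection
    rw [Submodule.orthogonal_orthogonal] at this
    rw [← this]; rfl
  have hπF : ∀ x ∈ F, π (x - f) = 0 := fun x hx => (hker _).2 (vsub_mem_vectorSpan ℝ hx hf)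
  have hπl : ∀ x, l (π x) = l x := by
    intro x
    have h1 : π (π x - x) = 0 := by
      rw [map_sub, sub_eq_zero]
      exact Submodule.starProjection_eq_self_iff.2 (Submodule.starProjection_apply_mem _ _)
    have := hlL _ ((hker _).1 h1)
    rwa [map_sub, sub_eq_zero] at this
  let W : E n → E n := fun s => (l f - l s)⁻¹ • π (s - f)
  set T : Finset (E n) := (S.filter (· ∉ F)).image W with hT
  have hpos : ∀ s ∈ S, s ∉ F → 0 < l f - l s := by
    intro s hs hsF
    have h1 := hlle s (hSP s hs)
    have h2 : l s ≠ l f := fun h => hsF ((hmemF s (hSP s hs)).2 h)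
    have := lt_of_le_of_ne h1 h2
    linarith
  have hπW : ∀ s ∈ S, s ∉ F → π (s - f) = (l f - l s) • W s := by
    intro s hs hsF
    simp only [W]
    rw [smul_smul, mul_inv_cancel₀ (hpos s hs hsF).ne', one_smul]
  have hlW : ∀ s ∈ S, s ∉ F → l (W s) = -1 := by
    intro s hs hsF
    simp only [W, map_smul, hπl, map_sub, smul_eq_mul]
    have := (hpos s hs hsF).ne'
    field_simp
    ring
  -- span of T
  have hspanT : Lᗮ ≤ Submodule.span ℝ (T : Set (E n)) := by
    have h1 : ∀ x ∈ P, π (x - f) ∈ Submodule.span ℝ (T : Set (E n)) := by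
      have hconv : Convex ℝ {x : E n | π (x - f) ∈ Submodule.span ℝ (T : Set (E n))} := by
        intro x hx y hy a b ha hb hab
        have : a • x + b • y - f = a • (x - f) + b • (y - f) := by
          have : f = (a + b) • f := by rw [hab, one_smul]
          nth_rewrite 1 [this]
          module
        simp only [Set.mem_setOf_eq] at *
        rw [this, map_add, map_smul, map_smul]
        exact add_mem (Submodule.smul_mem _ _ hx) (Submodule.smul_mem _ _ hy)
      apply convexHull_min _ hconv
      intro s hs
      by_cases hsF : s ∈ F
      · simp [-map_sub, hπF s hsF]
      · simp only [Set.mem_setOf_eq]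
        rw [hπW s hs hsF]
        apply Submodule.smul_mem
        apply Submodule.subset_span
        rw [hT]
        exact Finset.mem_coe.2 (Finset.mem_image.2 ⟨s, Finset.mem_filter.2 ⟨hs, hsF⟩, rfl⟩)
    have h2 : (⊤ : Submodule ℝ (E n)) ≤ (Submodule.span ℝ (T : Set (E n))).comap π.toLinearMap := by
      have h3 : vectorSpan ℝ P = ⊤ := by
        rw [← direction_affineSpan, hspan, AffineSubspace.direction_top]
      rw [← h3, vectorSpan_eq_span_vsub_set_right ℝ hfP, Submodule.span_le]
      rintro _ ⟨x, hx, rfl⟩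
      exact h1 x hx
    intro x hx
    have := h2 (Submodule.mem_top (x := x))
    have hx' : π x = x := Submodule.starProjection_eq_self_iff.2 hx
    rw [Submodule.mem_comap] at this
    change π x ∈ _ at this
    rwa [hx'] at this
  obtain ⟨X, hXT, hXspan, hXg⟩ := aux_span T
  have hcardX : n - k ≤ X.card := by
    have h1 := L.finrank_add_finrank_orthogonal
    rw [hdimL, finrank_euclideanSpace_fin] at h1
    have h2 := Submodule.finrank_mono hspanT
    rw [hXspan] at h2
    have h3 := finrank_span_finset_le_card (R := ℝ) X
    rw [Set.finrank] at h3
    omega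
  -- the faces
  have key : ∀ w ∈ X, ∃ G : Set (E n), (IsIFace P G (k + 1) ∧ F ⊆ G) ∧
      (∃ s ∈ S, s ∉ F ∧ W s = w ∧ s ∈ G) ∧ ∀ s ∈ S, s ∈ G → s ∉ F → W s = w := by
    intro w hw
    obtain ⟨g, hg⟩ := hXg w hw
    set h : E n →L[ℝ] ℝ := g.comp π + (g w) • l with hh
    have hhF : ∀ x ∈ F, h x = h f := by
      intro x hx
      have h1 : h (x - f) = 0 := by
        have := (hmemF x (hFe.subset hx)).1 hx
        simp only [hh, ContinuousLinearMap.add_apply, ContinuousLinearMap.comp_apply, hπF x hx,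
          ContinuousLinearMap.smul_apply, map_zero, map_sub l, this]
        simp
      rw [map_sub, sub_eq_zero] at h1
      exact h1
    have hhS : ∀ s ∈ S, s ∉ F → h s - h f = (l f - l s) * (g (W s) - g w) := by
      intro s hs hsF
      rw [← map_sub]
      simp only [hh, ContinuousLinearMap.add_apply, ContinuousLinearMap.comp_apply, hπW s hs hsF,
          ContinuousLinearMap.smul_apply, map_sub l, map_smul, smul_eq_mul]
      ring
    have hWT : ∀ s ∈ S, s ∉ F → W s ∈ T := fun s hs hsF =>
      Finset.mem_image.2 ⟨s, Finset.mem_filter.2 ⟨hs, hsF⟩, rfl⟩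
    have hhSle : ∀ s ∈ S, h s ≤ h f := by
      intro s hs
      by_cases hsF : s ∈ F
      · exact (hhF s hsF).le
      · by_cases hsw : W s = w
        · have := hhS s hs hsF
          rw [hsw] at this
          simp at this
          linarith
        · have h1 := hg _ (hWT s hs hsF) hsw
          have := hhS s hs hsF
          nlinarith [hpos s hs hsF]
    have hhle : ∀ x ∈ P, h x ≤ h f := by
      have : Convex ℝ {x : E n | h x ≤ h f} := convex_halfSpace_le h.toLinearMap.isLinear _
      exact convexHull_min hhSle this
    have hhSw : ∀ s ∈ S, s ∉ F → (h s = h f ↔ W s = w) := by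
      intro s hs hsF
      constructor
      · intro h1
        by_contra hsw
        have h2 := hg _ (hWT s hs hsF) hsw
        have := hhS s hs hsF
        nlinarith [hpos s hs hsF]
      · intro hsw
        have := hhS s hs hsF
        rw [hsw] at this
        simp at this
        linarith
    set G := h.toExposed P with hG
    have hGe : IsExposed ℝ P G := ContinuousLinearMap.toExposed.isExposed
    have hmemG : ∀ x ∈ P, (x ∈ G ↔ h x = h f) := by
      intro x hx
      constructor
      · intro h1
        exact le_antisymm (hhle x hx) (h1.2 f hfP)
      · intro h1
        exact ⟨hx, fun y hy => by rw [h1]; exact hhle y hy⟩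
    have hFG : F ⊆ G := fun x hx => (hmemG x (hFe.subset hx)).2 (hhF x hx)
    obtain ⟨s, hs, hsw⟩ := Finset.mem_image.1 (hXT hw)
    obtain ⟨hs, hsF⟩ := Finset.mem_filter.1 hs
    have hsG : s ∈ G := (hmemG s (hSP s hs)).2 ((hhSw s hs hsF).2 hsw)
    have hGdim : faceDim G = k + 1 := by
      rw [faceDim, direction_affineSpan]
      have hvs : vectorSpan ℝ G = L ⊔ Submodule.span ℝ {s - f} := by
        apply le_antisymm
        · rw [vectorSpan_eq_span_vsub_set_right ℝ (hFG hf), Submodule.span_le]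
          have hconv : Convex ℝ {x : E n | x - f ∈ L ⊔ Submodule.span ℝ {s - f}} := by
            intro x hx y hy a b ha hb hab
            have : a • x + b • y - f = a • (x - f) + b • (y - f) := by
              have : f = (a + b) • f := by rw [hab, one_smul]
              nth_rewrite 1 [this]
              module
            simp only [Set.mem_setOf_eq] at *
            rw [this]
            exact add_mem (Submodule.smul_mem _ _ hx) (Submodule.smul_mem _ _ hy)
          have hsub : G ⊆ {x : E n | x - f ∈ L ⊔ Submodule.span ℝ {s - f}} := by
            rw [aux_face_eq hGe]
            apply convexHull_min _ hconv
            rintro t ⟨ht, htG⟩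
            by_cases htF : t ∈ F
            · exact Submodule.mem_sup_left (vsub_mem_vectorSpan ℝ htF hf)
            · have htw := (hhSw t ht htF).1 ((hmemG t (hSP t ht)).1 htG)
              set c := (l f - l t) * (l f - l s)⁻¹ with hc
              have h1 : π ((t - f) - c • (s - f)) = 0 := by
                rw [map_sub π (t - f), map_smul, hπW t ht htF, hπW s hs hsF, htw, hsw, smul_smul,
                  hc, mul_assoc, inv_mul_cancel₀ (hpos s hs hsF).ne', mul_one, sub_self]
              have h2 : t - f = ((t - f) - c • (s - f)) + c • (s - f) := by abel
              simp only [Set.mem_setOf_eq]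
              rw [h2]
              exact Submodule.add_mem_sup ((hker _).1 h1)
                (Submodule.smul_mem _ _ (Submodule.mem_span_singleton_self _))
          rintro _ ⟨x, hx, rfl⟩
          exact hsub hx
        · apply sup_le
          · exact vectorSpan_mono ℝ hFG
          · rw [Submodule.span_singleton_le_iff_mem]
            exact vsub_mem_vectorSpan ℝ hsG (hFG hf)
      have hsL : s - f ∉ L := by
        intro h1
        have := hlL _ h1
        rw [map_sub] at this
        linarith [hpos s hs hsF]
      rw [hvs, Submodule.finrank_sup_span_singleton hsL, hdimL]
    refine ⟨G, ⟨⟨⟨⟨f, hFG hf⟩, ?_, hGe⟩, hGdim⟩, hFG⟩, ⟨s, hs, hsF, hsw, hsG⟩, ?_⟩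
    · intro hGP
      rw [hGP, faceDim, hspan, AffineSubspace.direction_top, finrank_top,
        finrank_euclideanSpace_fin] at hGdim
      omega
    · intro t ht htG htF
      exact (hhSw t ht htF).1 ((hmemG t (hSP t ht)).1 htG)
  choose! Φ hΦ1 hΦ2 hΦ3 using key
  refine hcardX.trans ?_
  rw [← Set.ncard_coe_finset]
  refine Set.ncard_le_ncard_of_injOn Φ (fun w hw => hΦ1 w hw) ?_ hfin
  intro w hw w' hw' heq
  obtain ⟨s, hs, hsF, hsw, hsG⟩ := hΦ2 w hw
  rw [heq] at hsG
  rw [← hsw, hΦ3 w' hw' s hs hsG hsF]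

theorem aux_edge {n : ℕ} {P e : Set (E n)} (hP : IsPolytope P) (he : IsIFace P e 1) :
    {V : Set (E n) | IsIFace P V 0 ∧ V ⊆ e}.ncard ≤ 2 := by
  have hfin : {V : Set (E n) | IsIFace P V 0 ∧ V ⊆ e}.Finite :=
    (aux_finite hP).subset (fun G hG => hG.1.1)
  by_contra hlt
  push Not at hlt
  rw [Set.two_lt_ncard_iff hfin] at hlt
  have hpt : ∀ V : Set (E n), IsIFace P V 0 → ∃ v, V = {v} ∧ v ∈ P.extremePoints ℝ := by
    rintro V ⟨⟨⟨v, hv⟩, -, hVe⟩, hd⟩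
    rw [faceDim, direction_affineSpan, Submodule.finrank_eq_zero, vectorSpan_eq_bot_iff_subsingleton] at hd
    have : V = {v} := hd.eq_singleton_of_mem hv
    refine ⟨v, this, ?_⟩
    subst this
    exact exposedPoints_subset_extremePoints (mem_exposedPoints_iff_exposed_singleton.2 hVe)
  obtain ⟨A, B, C, ⟨hA, hAe⟩, ⟨hB, hBe⟩, ⟨hC, hCe⟩, hAB, hAC, hBC⟩ := hlt
  obtain ⟨a, rfl, ha⟩ := hpt A hA
  obtain ⟨b, rfl, hb⟩ := hpt B hB
  obtain ⟨c, rfl, hc⟩ := hpt C hC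
  have hab : a ≠ b := fun h => hAB (by rw [h])
  have hac : a ≠ c := fun h => hAC (by rw [h])
  have hbc : b ≠ c := fun h => hBC (by rw [h])
  have hcol : Collinear ℝ e := by
    rw [collinear_iff_finrank_le_one, ← direction_affineSpan]
    exact he.2.le
  have hcol3 : Collinear ℝ ({a, b, c} : Set (E n)) := by
    apply hcol.subset
    rintro x (rfl | rfl | rfl)
    exacts [hAe rfl, hBe rfl, hCe rfl]
  have hno : ∀ x y z : E n, x ∈ P.extremePoints ℝ → y ∈ P.extremePoints ℝ →
      z ∈ P.extremePoints ℝ → x ≠ y → z ≠ y → ¬ Wbtw ℝ x y z := by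
    intro x y z hx hy hz hxy hzy hw
    rcases (mem_extremePoints_iff_forall_segment.1 hy).2 x hx.1 z hz.1 hw.mem_segment with h | h
    exacts [hxy h, hzy h]
  rcases hcol3.wbtw_or_wbtw_or_wbtw with h | h | h
  · exact hno _ _ _ ha hb hc hab hbc.symm h
  · exact hno _ _ _ hb hc ha hbc hac h
  · exact hno _ _ _ hc ha hb hac.symm hab.symm h

theorem aux_double {α β : Type*} (A : Finset α) (B : Finset β) (r : α → β → Prop) :
    ∑ a ∈ A, {b | b ∈ B ∧ r a b}.ncard = ∑ b ∈ B, {a | a ∈ A ∧ r a b}.ncard := by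
  classical
  have h := Finset.sum_card_bipartiteAbove_eq_sum_card_bipartiteBelow (s := A) (t := B) r
  have h1 : ∀ a, {b | b ∈ B ∧ r a b}.ncard = (B.bipartiteAbove r a).card := by
    intro a
    rw [← Set.ncard_coe_finset]
    congr 1
    ext b
    simp [Finset.bipartiteAbove]
  have h2 : ∀ b, {a | a ∈ A ∧ r a b}.ncard = (A.bipartiteBelow r b).card := by
    intro b
    rw [← Set.ncard_coe_finset]
    congr 1
    ext a
    simp [Finset.bipartiteBelow]
  simp_rw [h1, h2]
  exact h

/-- **Intermediate inequality (7).** If every vertex of an `n`-dimensional simple polytope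
(`n ≥ 3`) lies in at most `n+6` quadrilateral 2-faces and `α₂^{(1)} < 4(n-1+ε)/(n-2+ε)`,
then `m₄/α₂ < 2(n+6)(n-1+ε)/(n(n-1)(n-2+ε))`. -/
theorem quad_ratio_lt (n : ℕ) (hn : 3 ≤ n) (P : Set (E n))
    (hP : IsSimplePolytope n P) (ε : ℝ) (hε : ε = if Even n then 0 else 1)
    (hquad : ∀ V : Set (E n), IsIFace P V 0 →
      {F : Set (E n) | IsIFace P F 2 ∧ nFacesIn P F 0 = 4 ∧ V ⊆ F}.ncard ≤ n + 6)
    (hnik : avgFaces P 2 1 < 4 * ((n : ℝ) - 1 + ε) / ((n : ℝ) - 2 + ε)) :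
    (m2Faces P 4 : ℝ) / (nFaces P 2 : ℝ) <
      2 * ((n : ℝ) + 6) * ((n : ℝ) - 1 + ε) /
        ((n : ℝ) * ((n : ℝ) - 1) * ((n : ℝ) - 2 + ε)) := by
  obtain ⟨hPp, hspan, -⟩ := hP
  have hfin : ∀ i, (facesOf P i).Finite := fun i => (aux_finite hPp).subset (fun G hG => hG.1)
  set A0 := (hfin 0).toFinset with hA0
  set A1 := (hfin 1).toFinset with hA1
  set A2 := (hfin 2).toFinset with hA2
  have m0 : ∀ V, V ∈ A0 ↔ IsIFace P V 0 := fun V => by simp [hA0, facesOf]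
  have m1 : ∀ V, V ∈ A1 ↔ IsIFace P V 1 := fun V => by simp [hA1, facesOf]
  have m2 : ∀ V, V ∈ A2 ↔ IsIFace P V 2 := fun V => by simp [hA2, facesOf]
  have hqf : {F : Set (E n) | IsIFace P F 2 ∧ nFacesIn P F 0 = 4}.Finite :=
    (hfin 2).subset (fun F hF => hF.1)
  set Q := hqf.toFinset with hQ
  have mQ : ∀ F, F ∈ Q ↔ (IsIFace P F 2 ∧ nFacesIn P F 0 = 4) := fun F => by simp [hQ]
  -- vertices and edges
  have e1 : n * A0.card ≤ 2 * A1.card := by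
    have hd := aux_double A0 A1 (fun V e => V ⊆ e)
    simp only [m0, m1] at hd
    calc n * A0.card = ∑ _V ∈ A0, n := by simp [mul_comm]
      _ ≤ ∑ V ∈ A0, {b | IsIFace P b 1 ∧ V ⊆ b}.ncard := by
        apply Finset.sum_le_sum
        intro V hV
        have := aux_up hPp hspan (k := 0) (by omega) ((m0 V).1 hV)
        simpa using this
      _ = _ := hd
      _ ≤ ∑ _e ∈ A1, 2 := Finset.sum_le_sum (fun e he => aux_edge hPp ((m1 e).1 he))
      _ = 2 * A1.card := by simp [mul_comm]
  -- edges and 2-faces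
  have e2 : (n - 1) * A1.card ≤ ∑ F ∈ A2, nFacesIn P F 1 := by
    have hd := aux_double A1 A2 (fun V e => V ⊆ e)
    simp only [m2, m1] at hd
    calc (n - 1) * A1.card = ∑ _V ∈ A1, (n - 1) := by simp [mul_comm]
      _ ≤ ∑ V ∈ A1, {b | IsIFace P b 2 ∧ V ⊆ b}.ncard := by
        apply Finset.sum_le_sum
        intro V hV
        exact aux_up hPp hspan (k := 1) (by omega) ((m1 V).1 hV)
      _ = _ := hd
  -- quadrilaterals
  have e3 : 4 * Q.card ≤ (n + 6) * A0.card := by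
    have hd := aux_double Q A0 (fun F V => V ⊆ F)
    simp only [m0, mQ] at hd
    calc 4 * Q.card = ∑ _F ∈ Q, 4 := by simp [mul_comm]
      _ = ∑ F ∈ Q, {b | IsIFace P b 0 ∧ b ⊆ F}.ncard :=
        Finset.sum_congr rfl (fun F hF => ((mQ F).1 hF).2.symm)
      _ = _ := hd
      _ ≤ ∑ _V ∈ A0, (n + 6) := by
        apply Finset.sum_le_sum
        intro V hV
        have := hquad V ((m0 V).1 hV)
        simpa only [and_assoc] using this
      _ = _ := by simp [mul_comm]
  have hm : m2Faces P 4 = Q.card := Set.ncard_eq_toFinset_card _ hqf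
  have ha : nFaces P 2 = A2.card := Set.ncard_eq_toFinset_card _ (hfin 2)
  have hsum : ∑ᶠ f ∈ facesOf P 2, (nFacesIn P f 1 : ℝ) = ((∑ F ∈ A2, nFacesIn P F 1 : ℕ) : ℝ) := by
    rw [finsum_mem_eq_finite_toFinset_sum _ (hfin 2)]
    push_cast
    rfl
  rw [avgFaces, hsum, ha] at hnik
  rw [hm, ha]
  generalize (∑ F ∈ A2, nFacesIn P F 1 : ℕ) = Sg at *
  have hn' : (3 : ℝ) ≤ n := by exact_mod_cast hn
  have hε0 : 0 ≤ ε := by rw [hε]; split_ifs <;> norm_num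
  have p1 : (0 : ℝ) < n - 1 + ε := by linarith
  have p2 : (0 : ℝ) < n - 2 + ε := by linarith
  have p3 : (0 : ℝ) < n - 1 := by linarith
  have p4 : (0 : ℝ) < n := by linarith
  have e1' : (n : ℝ) * A0.card ≤ 2 * A1.card := by exact_mod_cast e1
  have e2' : ((n : ℝ) - 1) * A1.card ≤ Sg := by
    have : (((n - 1 : ℕ) : ℝ)) * A1.card ≤ Sg := by exact_mod_cast e2
    rwa [Nat.cast_sub (by omega), Nat.cast_one] at this
  have e3' : (4 : ℝ) * Q.card ≤ (n + 6) * A0.card := by exact_mod_cast e3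
  rcases Nat.eq_zero_or_pos A2.card with h0 | h0
  · rw [h0]
    simp only [Nat.cast_zero, div_zero]
    positivity
  have h0' : (0 : ℝ) < A2.card := by exact_mod_cast h0
  have hnik' : (Sg : ℝ) * (n - 2 + ε) < 4 * (n - 1 + ε) * A2.card := by
    rw [one_div, inv_mul_eq_div, div_lt_div_iff₀ h0' p2] at hnik
    exact hnik
  rw [div_lt_div_iff₀ h0' (by positivity)]
  have f1 : (n : ℝ) * (n - 1) * A0.card ≤ 2 * Sg := by nlinarith
  have f2 : 4 * Q.card * ((n : ℝ) * (n - 1)) ≤ (n + 6) * (2 * Sg) := by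
    calc 4 * Q.card * ((n : ℝ) * (n - 1)) ≤ (n + 6) * A0.card * ((n : ℝ) * (n - 1)) := by gcongr
      _ = (n + 6) * ((n : ℝ) * (n - 1) * A0.card) := by ring
      _ ≤ _ := by gcongr
  have f3 : 4 * Q.card * ((n : ℝ) * (n - 1)) * (n - 2 + ε) ≤ (n + 6) * (2 * Sg) * (n - 2 + ε) := by
    gcongr
  have f4 : ((n : ℝ) + 6) * (Sg * (n - 2 + ε)) < (n + 6) * (4 * (n - 1 + ε) * A2.card) := by
    gcongr
  nlinarith
end
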